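/- (Alternating product convolution gives a Hall–Littlewood process, case k = 1.) Fix n ≥ 1, t ∈ (0,1), positive reals a_1,…,a_n, and nonnegative reals b_1,…,b_r and c_1,…,c_s with a_i b_j < 1 and a_i c_j < 1 for all i, j. Write a = (a_1,…,a_n), a' = (a_1, a_1 t, …, a_n, a_n t), and for lists u = (u_1,…,u_p), w = (w_1,…,w_q) and parameter τ set Π_τ(u;w) = ∏_{i,j} (1 − τ u_i w_j)/(1 − u_i w_j). For each μ ∈ Sig_{2n}^+ and κ, κ' ∈ Sig_n, let c_{μ,κ}^{alt,κ'}(t) ∈ ℝ be the evaluation at t of the unique finitely supported family of polynomials in ℤ[T] with P_μ(x_1, x_1 T, …, x_n, x_n T; T)·P_κ(x;T²) = ∑_{κ'} c_{μ,κ}^{alt,κ'}(T)·P_{κ'}(x;T²). Then for all λ, λ' ∈ Sig_n^+: [P_λ(a;t²)·Q_{λ/0[n]}(b;t²)/Π_{t²}(a;b)] · ∑_{μ ∈ Sig_{2n}^+} [P_μ(a';t)·Q_{μ/0[2n]}(c;t)/Π_t(a';c)] · [c_{μ,λ}^{alt,λ'}(t)·P_{λ'}(a;t²)/(P_μ(a';t)·P_λ(a;t²))]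 = Q_{λ/0[n]}(b;t²)·Q_{λ'/λ}(c;t²)·P_{λ'}(a;t²)/(Π_{t²}(a;b)·Π_{t²}(a;c)), where the sum over μ has only finitely many nonzero terms (c_{μ,λ}^{alt,λ'} = 0 unless |μ| = |λ'| − |λ|), all Hall–Littlewood polynomials are evaluated at the indicated real arguments, and all denominators appearing are nonzero. -/

import Mathlib

open scoped Classical

noncomputable section

/-- Sum of the parts of an integer tuple. -/
def sumz {p : ℕ} (l : Fin p → ℤ) : ℤ := ∑ i, l i

/-- `mcount l c = m_c(l)`, the number of parts of `l` equal to `c`. -/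
def mcount {p : ℕ} (l : Fin p → ℤ) (c : ℤ) : ℕ := (Finset.univ.filter fun j => l j = c).card

/-- `l` is a signature: its parts are weakly decreasing. -/
def IsSig {p : ℕ} (l : Fin p → ℤ) : Prop := ∀ i j : Fin p, i ≤ j → l j ≤ l i

/-- `μ ≺_P l`: `l i ≥ μ i ≥ l (i+1)` for all `i`. -/
def interP {m : ℕ} (μ : Fin m → ℤ) (l : Fin (m + 1) → ℤ) : Prop :=
  ∀ i : Fin m, μ i ≤ l i.castSucc ∧ l i.succ ≤ μ i

/-- `ν ≺_Q l`: `l i ≥ ν i` for all `i`, and `ν i ≥ l (i+1)`. -/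
def interQ {n : ℕ} (ν l : Fin n → ℤ) : Prop :=
  (∀ i, ν i ≤ l i) ∧ ∀ i j : Fin n, (j : ℕ) = (i : ℕ) + 1 → l j ≤ ν i

/-- `ψ_{l/μ}(t) = ∏_{i : m_i(μ) = m_i(l) + 1} (1 − t^{m_i(μ)})`. -/
def psiHL {K : Type} [Field K] {p : ℕ} (t : K) (l : Fin (p + 1) → ℤ) (μ : Fin p → ℤ) : K :=
  ∏ᶠ c : ℤ, if mcount μ c = mcount l c + 1 then 1 - t ^ mcount μ c else 1

/-- `φ_{l/ν}(t) = ∏_{i : m_i(l) = m_i(ν) + 1} (1 − t^{m_i(l)})`. -/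
def phiHL {K : Type} [Field K] {p : ℕ} (t : K) (l ν : Fin p → ℤ) : K :=
  ∏ᶠ c : ℤ, if mcount l c = mcount ν c + 1 then 1 - t ^ mcount l c else 1

/-- Skew Hall–Littlewood polynomial `P_{l/μ}(x₁,…,x_k;t)`, via the branching rule, as a
function of `x : Fin k → K`. -/
def HLP {K : Type} [Field K] {m : ℕ} (t : K) :
    (k : ℕ) → (Fin m → ℤ) → (Fin (m + k) → ℤ) → (Fin k → K) → K
  | 0, μ, l, _ => if μ = l then 1 else 0
  | k + 1, μ, l, x =>
    ∑ᶠ ν : Fin (m + k) → ℤ,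
      if interP ν l then
        psiHL t l ν * x (Fin.last k) ^ (sumz l - sumz ν) * HLP t k μ ν fun i => x i.castSucc
      else 0

/-- Skew Hall–Littlewood polynomial `Q_{l/ν}(x₁,…,x_k;t)` (`ν` and `l` both of length `n`),
via the branching rule, as a function of `x : Fin k → K`. -/
def HLQ {K : Type} [Field K] {n : ℕ} (t : K) :
    (k : ℕ) → (Fin n → ℤ) → (Fin n → ℤ) → (Fin k → K) → K
  | 0, ν, l, _ => if ν = l then 1 else 0
  | k + 1, ν, l, x =>
    ∑ᶠ κ : Fin n → ℤ,
      if interQ κ l then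
        phiHL t l κ * x (Fin.last k) ^ (sumz l - sumz κ) * HLQ t k ν κ fun i => x i.castSucc
      else 0

/-- The (non-skew) Hall–Littlewood polynomial `P_l(x₁,…,x_n;t) = P_{l/∅}(x₁,…,x_n;t)`. -/
def HLPfull {K : Type} [Field K] {n : ℕ} (t : K) (l : Fin n → ℤ) (x : Fin n → K) : K :=
  HLP t n (fun i : Fin 0 => 0) (fun i => l (Fin.cast (Nat.zero_add n) i)) x

/-- `poch t m = (t;t)_m = ∏_{j=1}^m (1 − t^j)`. -/
def poch {K : Type} [Field K] (t : K) (m : ℕ) : K := ∏ j ∈ Finset.range m, (1 - t ^ (j + 1))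


/-- The Cauchy kernel `Π_τ(u; w) = ∏_{i,j} (1 − τ uᵢ wⱼ)/(1 − uᵢ wⱼ)`. -/
def PiK {K : Type} [Field K] {p q : ℕ} (τ : K) (u : Fin p → K) (w : Fin q → K) : K :=
  ∏ i, ∏ j, (1 - τ * u i * w j) / (1 - u i * w j)

/-- The list `(x₁, x₁t, x₂, x₂t, …, x_n, x_n t)` of `2n` values. -/
def doubleList {K : Type} [Field K] {n : ℕ} (t : K) (x : Fin n → K) : Fin (2 * n) → K :=
  fun i => x ⟨i.val / 2, by have := i.isLt; omega⟩ * t ^ (i.val % 2)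

/-- `c` is a finitely supported family of polynomials in `ℤ[T]`, supported on signatures, with
`P_μ(x₁, x₁T, …, x_n, x_n T; T) · P_ν(x₁,…,x_n; T²) = ∑_λ c_λ(T) · P_λ(x₁,…,x_n; T²)` as
Laurent polynomials (formalized as holding over every field at nonzero arguments). -/
def altExpand (n : ℕ) (μ : Fin (2 * n) → ℤ) (ν : Fin n → ℤ)
    (c : (Fin n → ℤ) → Polynomial ℤ) : Prop :=
  {l : Fin n → ℤ | c l ≠ 0}.Finite ∧ (∀ l, c l ≠ 0 → IsSig l) ∧
  ∀ (K : Type) [Field K] (T : K) (x : Fin n → K), (∀ i, x i ≠ 0) →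
    HLPfull T μ (doubleList T x) * HLPfull (T ^ 2) ν x
      = ∑ᶠ l : Fin n → ℤ, Polynomial.aeval T (c l) * HLPfull (T ^ 2) l x

section PartA

/-- number of parts at least `c` -/
def cnt {p : ℕ} (l : Fin p → ℤ) (c : ℤ) : ℕ := (Finset.univ.filter fun j => c ≤ l j).card

lemma cnt_le {p : ℕ} (l : Fin p → ℤ) (c : ℤ) : cnt l c ≤ p := by
  unfold cnt
  exact (Finset.card_le_univ _).trans (by simp)

lemma le_iff_lt_cnt {p : ℕ} {l : Fin p → ℤ} (h : IsSig l) (c : ℤ) (j : Fin p) :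
    c ≤ l j ↔ (j : ℕ) < cnt l c := by
  constructor
  · intro hc
    have : (Finset.Iic j) ⊆ Finset.univ.filter fun j => c ≤ l j := by
      intro i hi
      simp only [Finset.mem_Iic] at hi
      simp only [Finset.mem_filter, Finset.mem_univ, true_and]
      exact hc.trans (h i j hi)
    have := Finset.card_le_card this
    simp only [Fin.card_Iic] at this
    unfold cnt
    omega
  · intro hc
    by_contra hn
    have : (Finset.univ.filter fun j => c ≤ l j) ⊆ Finset.Iio j := by
      intro i hi
      simp only [Finset.mem_filter, Finset.mem_univ, true_and] at hi
      simp only [Finset.mem_Iio]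
      by_contra hij
      exact hn (hi.trans (h j i (not_lt.mp hij)))
    have := Finset.card_le_card this
    simp only [Fin.card_Iio] at this
    unfold cnt at hc
    omega

lemma cnt_eq_add {p : ℕ} (l : Fin p → ℤ) (c : ℤ) : cnt l c = cnt l (c + 1) + mcount l c := by
  unfold cnt mcount
  rw [← Finset.card_union_of_disjoint]
  · congr 1
    ext j
    simp only [Finset.mem_filter, Finset.mem_univ, true_and, Finset.mem_union]
    omega
  · rw [Finset.disjoint_filter]
    intro j _ h1 h2
    omega

lemma sig_ext {p : ℕ} {l l' : Fin p → ℤ} (h : IsSig l) (h' : IsSig l')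
    (hc : ∀ c, cnt l c = cnt l' c) : l = l' := by
  funext j
  apply le_antisymm
  · rw [le_iff_lt_cnt h', ← hc, ← le_iff_lt_cnt h]
  · rw [le_iff_lt_cnt h, hc, ← le_iff_lt_cnt h']

lemma interP_iff {m : ℕ} {μ : Fin m → ℤ} {l : Fin (m + 1) → ℤ} (hμ : IsSig μ) (hl : IsSig l) :
    interP μ l ↔ ∀ c, cnt μ c ≤ cnt l c ∧ cnt l c ≤ cnt μ c + 1 := by
  constructor
  · intro h c
    constructor
    · by_contra hn
      push Not at hn
      have hj : cnt l c < m := hn.trans_le (cnt_le _ _)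
      have h1 := (le_iff_lt_cnt hμ c ⟨cnt l c, hj⟩).2 hn
      have h2 := (le_iff_lt_cnt hl c _).1 (h1.trans (h ⟨cnt l c, hj⟩).1)
      simp at h2
    · by_contra hn
      push Not at hn
      have hj : cnt μ c < m := by have := cnt_le l c; omega
      have h1 := (le_iff_lt_cnt hl c (Fin.succ ⟨cnt μ c, hj⟩)).2 (by simpa using hn)
      have h2 := (le_iff_lt_cnt hμ c _).1 (h1.trans (h ⟨cnt μ c, hj⟩).2)
      simp at h2
  · intro h i
    constructor
    · rw [le_iff_lt_cnt hl]
      have := (le_iff_lt_cnt hμ (μ i) i).1 le_rfl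
      have := (h (μ i)).1
      simp; omega
    · rw [le_iff_lt_cnt hμ]
      have := (le_iff_lt_cnt hl (l i.succ) i.succ).1 le_rfl
      have := (h (l i.succ)).2
      simp at *; omega

lemma interQ_iff {m : ℕ} {μ : Fin m → ℤ} {l : Fin m → ℤ} (hμ : IsSig μ) (hl : IsSig l) :
    interQ μ l ↔ ∀ c, cnt μ c ≤ cnt l c ∧ cnt l c ≤ cnt μ c + 1 := by
  constructor
  · intro h c
    constructor
    · by_contra hn
      push Not at hn
      have hj : cnt l c < m := hn.trans_le (cnt_le _ _)
      have h1 := (le_iff_lt_cnt hμ c ⟨cnt l c, hj⟩).2 hn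
      have h2 := (le_iff_lt_cnt hl c _).1 (h1.trans (h.1 ⟨cnt l c, hj⟩))
      simp at h2
    · by_contra hn
      push Not at hn
      have hj : cnt μ c + 1 < m := by have := cnt_le l c; omega
      have h1 := (le_iff_lt_cnt hl c ⟨cnt μ c + 1, hj⟩).2 (by simpa using hn)
      have h2 := (le_iff_lt_cnt hμ c _).1 (h1.trans (h.2 ⟨cnt μ c, by omega⟩ _ rfl))
      simp at h2
  · intro h
    constructor
    · intro i
      rw [le_iff_lt_cnt hl]
      have := (le_iff_lt_cnt hμ (μ i) i).1 le_rfl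
      have := (h (μ i)).1
      omega
    · intro i j hij
      rw [le_iff_lt_cnt hμ]
      have := (le_iff_lt_cnt hl (l j) j).1 le_rfl
      have := (h (l j)).2
      omega

/-- all parts lie in `[A, A+J)` -/
def InBox {p : ℕ} (A : ℤ) (J : ℕ) (l : Fin p → ℤ) : Prop := ∀ i, A ≤ l i ∧ l i < A + J

lemma cnt_low {p : ℕ} {A : ℤ} {J : ℕ} {l : Fin p → ℤ} (h : InBox A J l) {c : ℤ} (hc : c ≤ A) :
    cnt l c = p := by
  unfold cnt
  rw [Finset.filter_true_of_mem]
  · simp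
  · intro j _
    exact hc.trans (h j).1

lemma cnt_high {p : ℕ} {A : ℤ} {J : ℕ} {l : Fin p → ℤ} (h : InBox A J l) {c : ℤ}
    (hc : A + J ≤ c) : cnt l c = 0 := by
  unfold cnt
  rw [Finset.filter_false_of_mem]
  · simp
  · intro j _
    have := (h j).2
    omega

lemma sum_cnt {p : ℕ} {A : ℤ} {J : ℕ} {l : Fin p → ℤ} (h : InBox A J l) :
    ∑ i ∈ Finset.range J, (cnt l (A + i) : ℤ) = sumz l - p * A + p := by
  unfold cnt sumz
  have h1 : ∀ i ∈ Finset.range J, (((Finset.univ.filter fun j => A + (i:ℤ) ≤ l j).card : ℕ) : ℤ)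
      = ∑ j, if A + (i:ℤ) ≤ l j then 1 else 0 := by
    intro i _
    simp
  rw [Finset.sum_congr rfl h1, Finset.sum_comm]
  have h2 : ∀ j, ∑ i ∈ Finset.range J, (if A + (i:ℤ) ≤ l j then (1:ℤ) else 0) = l j - A + 1 := by
    intro j
    have := h j
    rw [← Finset.sum_filter]
    have h3 : (Finset.range J).filter (fun i : ℕ => A + (i:ℤ) ≤ l j)
        = Finset.range (l j - A + 1).toNat := by
      ext i
      simp only [Finset.mem_filter, Finset.mem_range]
      omega
    rw [h3]
    simp
    omega
  rw [Finset.sum_congr rfl (fun j _ => h2 j)]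
  simp [Finset.sum_add_distrib]

lemma exists_sig (p : ℕ) (A : ℤ) (J : ℕ) (L : ℕ → ℤ) (hA : L 0 = p) (hJ : L J = 0)
    (hL : ∀ i < J, L (i + 1) ≤ L i) :
    ∃ l : Fin p → ℤ, IsSig l ∧ InBox A J l ∧ ∀ i ≤ J, (cnt l (A + i) : ℤ) = L i := by
  have hanti : ∀ j k, j + k ≤ J → L (j + k) ≤ L j := by
    intro j k
    induction k with
    | zero => intro _; simp
    | succ k ih =>
      intro hk
      exact (hL (j + k) (by omega)).trans (ih (by omega))
  have hanti' : ∀ j k, j ≤ k → k ≤ J → L k ≤ L j := by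
    intro j k h1 h2
    have := hanti j (k - j) (by omega)
    rwa [Nat.add_sub_cancel' h1] at this
  -- number of indices in `range J`-shifted with `i < L (k+1)`
  let N : Fin p → ℕ := fun i => ((Finset.range J).filter fun k => (i : ℤ) < L k).card
  have hN : ∀ (i : Fin p) (k : ℕ), k < J → ((i : ℤ) < L k ↔ k < N i) := by
    intro i k hk
    constructor
    · intro h
      have : Finset.range (k + 1) ⊆ (Finset.range J).filter fun k => (i : ℤ) < L k := by
        intro a ha
        simp only [Finset.mem_range, Finset.mem_filter] at *
        exact ⟨by omega, h.trans_le (hanti' a k (by omega) (by omega))⟩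
      have := Finset.card_le_card this
      simp only [Finset.card_range] at this
      exact this
    · intro h
      by_contra hn
      have : (Finset.range J).filter (fun k => (i : ℤ) < L k) ⊆ Finset.range k := by
        intro a ha
        simp only [Finset.mem_range, Finset.mem_filter] at *
        by_contra hka
        exact hn (ha.2.trans_le (hanti' k a (by omega) (by omega)))
      have := Finset.card_le_card this
      simp only [Finset.card_range] at this
      have h' : k < ((Finset.range J).filter fun k => (i : ℤ) < L k).card := h
      omega
  have hNJ : ∀ i, N i ≤ J := by
    intro i
    exact (Finset.card_filter_le _ _).trans (by simp)
  have hN1 : ∀ i, 1 ≤ N i := by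
    intro i
    have hi := i.2
    have hJ0 : 0 < J := by
      rcases Nat.eq_zero_or_pos J with h | h
      · subst h; omega
      · exact h
    exact (hN i 0 hJ0).1 (by rw [hA]; exact_mod_cast hi)
  refine ⟨fun i => A + N i - 1, ?_, ?_, ?_⟩
  · intro i j hij
    have : N j ≤ N i := by
      apply Finset.card_le_card
      intro a ha
      simp only [Finset.mem_range, Finset.mem_filter] at *
      refine ⟨ha.1, lt_of_le_of_lt ?_ ha.2⟩
      exact_mod_cast hij
    show A + (N j : ℤ) - 1 ≤ A + N i - 1
    omega
  · intro i
    have := hN1 i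
    have := hNJ i
    show A ≤ A + (N i : ℤ) - 1 ∧ A + (N i : ℤ) - 1 < A + J
    constructor <;> omega
  · intro k hk
    have h0 : 0 ≤ L k := by rw [← hJ]; exact hanti' k J hk le_rfl
    have h1 : L k ≤ p := by rw [← hA]; exact hanti' 0 k (by omega) hk
    have : (Finset.univ.filter fun j : Fin p => A + (k:ℤ) ≤ A + N j - 1)
        = Finset.univ.filter fun j : Fin p => (j : ℕ) < (L k).toNat := by
      ext j
      simp only [Finset.mem_filter, Finset.mem_univ, true_and]
      rcases Nat.lt_or_ge k J with h | h
      · have := hN j k h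
        omega
      · have : k = J := by omega
        subst this
        have := hNJ j
        rw [hJ]
        simp
        omega
    unfold cnt
    rw [this]
    have h2 : (Finset.univ.filter fun j : Fin p => (j : ℕ) < (L k).toNat).card = min p (L k).toNat := by
      rw [Fin.card_filter_val_lt]
    rw [h2]
    omega

lemma sig_of_interQ {n : ℕ} {κ l : Fin n → ℤ} (h : interQ κ l) : IsSig κ ∧ IsSig l := by
  have key : ∀ (g : Fin n → ℤ), (∀ i j : Fin n, (j : ℕ) = i + 1 → g j ≤ g i) → IsSig g := by
    intro g hg i j hij
    obtain ⟨i, hi⟩ := i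
    obtain ⟨j, hj⟩ := j
    simp only [Fin.mk_le_mk] at hij
    induction j, hij using Nat.le_induction with
    | base => exact le_rfl
    | succ k hk ih =>
      exact (hg ⟨k, by omega⟩ ⟨k + 1, hj⟩ rfl).trans (ih (by omega))
  exact ⟨key _ fun i j hij => (h.1 j).trans (h.2 i j hij),
    key _ fun i j hij => (h.2 i j hij).trans (h.1 i)⟩

lemma sig_of_interP {n : ℕ} {κ : Fin n → ℤ} {l : Fin (n + 1) → ℤ} (h : interP κ l) :
    IsSig κ ∧ IsSig l := by
  have key : ∀ (n : ℕ) (g : Fin n → ℤ), (∀ i j : Fin n, (j : ℕ) = i + 1 → g j ≤ g i) → IsSig g := by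
    intro n g hg i j hij
    obtain ⟨i, hi⟩ := i
    obtain ⟨j, hj⟩ := j
    simp only [Fin.mk_le_mk] at hij
    induction j, hij using Nat.le_induction with
    | base => exact le_rfl
    | succ k hk ih =>
      exact (hg ⟨k, by omega⟩ ⟨k + 1, hj⟩ rfl).trans (ih (by omega))
  constructor
  · apply key
    intro i j hij
    have h1 := (h j).1
    have h2 := (h i).2
    have : j.castSucc = i.succ := by ext; simp [hij]
    rw [this] at h1
    exact h1.trans h2
  · apply key
    intro i j hij
    have hi : (i : ℕ) < n := by omega
    have h1 := (h ⟨i, hi⟩)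
    have e1 : (Fin.castSucc ⟨i, hi⟩ : Fin (n + 1)) = i := by ext; simp
    have e2 : (Fin.succ ⟨i, hi⟩ : Fin (n + 1)) = j := by ext; simp [hij]
    rw [e1, e2] at h1
    exact h1.2.trans h1.1

end PartA

section PartB

/-- local weight: `d, d'` are the differences at the lower and upper side, `a, b` the states. -/
def lw {R : Type} [CommRing R] (t : R) (N M : ℕ → ℤ) (i : ℕ) (a b : Fin 2) : R :=
  if (0 ≤ (a : ℤ) + (N i - M i) ∧ (a : ℤ) + (N i - M i) ≤ 1) ∧
     (0 ≤ (b : ℤ) + (N (i+1) - M (i+1)) ∧ (b : ℤ) + (N (i+1) - M (i+1)) ≤ 1) then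
    (if a = 1 ∧ b = 0 then 1 - t ^ ((N i - N (i+1)).toNat + 1) else 1) *
    (if (a : ℤ) + (N i - M i) = 0 ∧ (b : ℤ) + (N (i+1) - M (i+1)) = 1 then
      1 - t ^ (M i - M (i+1)).toNat else 1)
  else 0

/-- transfer recursion -/
def tr {R : Type} [CommRing R] (W : ℕ → Fin 2 → Fin 2 → R) (u : Fin 2 → R) :
    ℕ → ℕ → Fin 2 → R
  | 0, _, a => u a
  | J + 1, c, a => W c a 0 * tr W u J (c + 1) 0 + W c a 1 * tr W u J (c + 1) 1

lemma tr_eq_sum {R : Type} [CommRing R] (W : ℕ → Fin 2 → Fin 2 → R) (u : Fin 2 → R) (J : ℕ) :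
    ∀ (c : ℕ) (a : Fin 2), tr W u J c a = ∑ f : Fin (J + 1) → Fin 2,
      if f 0 = a then (∏ i : Fin J, W (c + i) (f i.castSucc) (f i.succ)) * u (f (Fin.last J))
      else 0 := by
  induction J with
  | zero =>
    intro c a
    rw [← (Equiv.funUnique (Fin 1) (Fin 2)).symm.sum_comp]
    simp [tr]
  | succ J ih =>
    intro c a
    rw [← (Fin.consEquiv (fun _ : Fin (J + 2) => Fin 2)).sum_comp]
    rw [Fintype.sum_prod_type]
    simp only [Fin.consEquiv_apply, Fin.cons_zero]
    rw [Finset.sum_eq_single a]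
    · simp only [if_true]
      simp only [tr]
      rw [ih, ih, Finset.mul_sum, Finset.mul_sum, ← Finset.sum_add_distrib]
      apply Finset.sum_congr rfl
      intro f _
      rw [Fin.prod_univ_succ]
      have e : Fin.last (J + 1) = (Fin.last J).succ := rfl
      simp only [Fin.castSucc_zero, Fin.cons_zero, Fin.cons_succ, ← Fin.succ_castSucc, e,
        Fin.val_succ, Fin.val_zero, add_zero]
      have e2 : ∀ i : Fin J, c + ((i : ℕ) + 1) = c + 1 + i := fun i => by ring
      simp only [e2]
      generalize (∏ i : Fin J, W (c + 1 + i) (f i.castSucc) (f i.succ)) = PP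
      have h2 : f 0 = 0 ∨ f 0 = 1 := by
        generalize f 0 = y
        fin_cases y <;> simp
      rcases h2 with h | h <;> rw [h] <;> simp [mul_assoc]
    · intro b _ hb
      simp [hb]
    · simp

variable {R : Type} [CommRing R]

def WS (t z : R) (N M : ℕ → ℤ) (i : ℕ) (a b : Fin 2) : R := z ^ (a : ℕ) * lw t N M i a b
def WT (t z : R) (N M : ℕ → ℤ) (i : ℕ) (a b : Fin 2) : R :=
  z ^ (1 - (N i - M i) - a).toNat * lw t N M i a b
def uS (R : Type) [CommRing R] : Fin 2 → R := ![1, 0]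
def uT (R : Type) [CommRing R] : Fin 2 → R := ![0, 1]

/-- the invariant relating the two transfer vectors -/
def TInv (t z e : R) (δ : ℤ) (S T : Fin 2 → R) : Prop :=
  (δ = 0 → e ∣ (1 - z) * S 0 - ((1 - t) * T 0 + (1 - z) * T 1) ∧
    e ∣ (1 - z) * S 1 - (t * (1 - z) * T 0 + z * (1 - t) * T 1)) ∧
  (δ = 1 → e ∣ (1 - z) * S 0 - (1 - t * z) * T 0) ∧
  (δ = -1 → e ∣ (1 - z) * S 1 - (1 - t * z) * T 1)

lemma inv_step (t z e : R) (N M : ℕ → ℤ) (i : ℕ) (hN : N (i+1) ≤ N i) (hM : M (i+1) ≤ M i)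
    (S T S' T' : Fin 2 → R)
    (h : TInv t z e (N (i+1) - M (i+1)) S' T')
    (hS : ∀ a, S a = WS t z N M i a 0 * S' 0 + WS t z N M i a 1 * S' 1)
    (hT : ∀ a, T a = WT t z N M i a 0 * T' 0 + WT t z N M i a 1 * T' 1) :
    TInv t z e (N i - M i) S T := by
  obtain ⟨h0, h1, h2⟩ := h
  obtain ⟨n, hn⟩ : ∃ n : ℕ, N i = N (i+1) + n := ⟨(N i - N (i+1)).toNat, by omega⟩
  obtain ⟨m, hm⟩ : ∃ m : ℕ, M i = M (i+1) + m := ⟨(M i - M (i+1)).toNat, by omega⟩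
  generalize hdlt : N (i+1) - M (i+1) = dlt at *
  have hδ : N i - M i = dlt + n - m := by omega
  have hn' : (N i - N (i+1)).toNat = n := by omega
  have hm' : (M i - M (i+1)).toNat = m := by omega
  have hlw : ∀ a b : Fin 2, lw t N M i a b = 
    if (0 ≤ (a : ℤ) + (dlt + n - m) ∧ (a : ℤ) + (dlt + n - m) ≤ 1) ∧
     (0 ≤ (b : ℤ) + dlt ∧ (b : ℤ) + dlt ≤ 1) then
    (if a = 1 ∧ b = 0 then 1 - t ^ (n + 1) else 1) *
    (if (a : ℤ) + (dlt + n - m) = 0 ∧ (b : ℤ) + dlt = 1 then 1 - t ^ m else 1) else 0 := by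
    intro a b
    unfold lw
    rw [hdlt, hδ, hn', hm']
  simp only [WS, WT, hlw, hδ] at hS hT
  rw [hδ]
  clear hlw hn' hm' hδ hdlt hn hm hN hM
  have big : (dlt ≤ -2 ∨ 2 ≤ dlt) ∨ dlt = 0 ∨ dlt = 1 ∨ dlt = -1 := by omega
  unfold TInv
  rcases big with hb | rfl | rfl | rfl
  · have hz : ∀ b : Fin 2, ¬ (0 ≤ (b : ℤ) + dlt ∧ (b : ℤ) + dlt ≤ 1) := by
      intro b; have := b.2; omega
    simp only [hz, and_false, if_false, mul_zero, zero_mul, add_zero] at hS hT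
    simp [hS, hT]
  · obtain ⟨h0a, h0b⟩ := h0 rfl
    refine ⟨fun h => ?_, fun h => ?_, fun h => ?_⟩
    · simp only [h] at hS hT
      obtain rfl : n = m := by omega
      constructor
      · have := dvd_add h0a (dvd_mul_of_dvd_right h0b (1 - t ^ n))
        convert this using 1
        simp [hS, hT]
        ring
      · have := dvd_mul_of_dvd_right (dvd_add (dvd_mul_of_dvd_right h0a (1 - t ^ (n + 1))) h0b) z
        convert this using 1
        simp [hS, hT]
        ring
    · simp only [h] at hS hT
      obtain rfl : n = m + 1 := by omega
      have := dvd_add h0a h0b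
      convert this using 1
      simp [hS, hT]
      ring
    · simp only [h] at hS hT
      obtain rfl : m = n + 1 := by omega
      have := dvd_mul_of_dvd_right (dvd_add h0a h0b) (z * (1 - t ^ (n + 1)))
      convert this using 1
      simp [hS, hT]
      ring
  · have h1 := h1 rfl
    refine ⟨fun h => ?_, fun h => ?_, fun h => ?_⟩
    · simp only [h] at hS hT
      obtain rfl : m = n + 1 := by omega
      constructor
      · have := dvd_mul_of_dvd_right h1 (1 - t ^ (n + 1))
        convert this using 1
        simp [hS, hT]
        ring
      · have := dvd_mul_of_dvd_right h1 (z * (1 - t ^ (n + 1)))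
        convert this using 1
        simp [hS, hT]
        ring
    · simp only [h] at hS hT
      obtain rfl : n = m := by omega
      convert h1 using 1
      simp [hS, hT]
    · simp only [h] at hS hT
      obtain rfl : m = n + 2 := by omega
      have := dvd_mul_of_dvd_right h1 (z * (1 - t ^ (n + 1)) * (1 - t ^ (n + 2)))
      convert this using 1
      simp [hS, hT]
      ring
  · have h2 := h2 rfl
    refine ⟨fun h => ?_, fun h => ?_, fun h => ?_⟩
    · simp only [h] at hS hT
      obtain rfl : n = m + 1 := by omega
      constructor
      · convert h2 using 1
        simp [hS, hT]
        ring
      · have := dvd_mul_of_dvd_right h2 z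
        convert this using 1
        simp [hS, hT]
        ring
    · simp only [h] at hS hT
      obtain rfl : n = m + 2 := by omega
      convert h2 using 1
      simp [hS, hT]
    · simp only [h] at hS hT
      obtain rfl : n = m := by omega
      have := dvd_mul_of_dvd_right h2 z
      convert this using 1
      simp [hS, hT]
      ring

lemma tr_top (t z : R) (N M : ℕ → ℤ) (B : ℕ) (hN : ∀ i, B ≤ i → N i = 0)
    (hM : ∀ i, B ≤ i → M i = 0) (k : ℕ) : ∀ i, B ≤ i →
    tr (WS t z N M) (uS R) k i 0 = 1 ∧ tr (WT t z N M) (uT R) k i 0 = 0 ∧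
    tr (WT t z N M) (uT R) k i 1 = 1 ∧
    (1 - z) * tr (WS t z N M) (uS R) k i 1 = z * (1 - t) * (1 - z ^ k) := by
  induction k with
  | zero =>
    intro i hi
    simp [tr, uS, uT]
  | succ k ih =>
    intro i hi
    obtain ⟨h1, h2, h3, h4⟩ := ih (i + 1) (by omega)
    have e1 := hN i hi
    have e2 := hN (i + 1) (by omega)
    have e3 := hM i hi
    have e4 := hM (i + 1) (by omega)
    simp only [tr, h1, h2, h3]
    refine ⟨?_, ?_, ?_, ?_⟩
    · simp [WS, lw, e1, e2, e3, e4]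
    · simp [WT, lw, e1, e2, e3, e4]
    · simp [WT, lw, e1, e2, e3, e4]
    · simp [WS, lw, e1, e2, e3, e4]
      linear_combination z * h4

lemma tr_main (t z : R) (N M : ℕ → ℤ) (B k : ℕ) (hN : ∀ i, B ≤ i → N i = 0)
    (hM : ∀ i, B ≤ i → M i = 0) (hN' : ∀ i, N (i+1) ≤ N i) (hM' : ∀ i, M (i+1) ≤ M i) :
    ∀ j i, i + j = B → TInv t z (z ^ k) (N i - M i)
      (tr (WS t z N M) (uS R) (j + k) i) (tr (WT t z N M) (uT R) (j + k) i) := by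
  intro j
  induction j with
  | zero =>
    intro i hi
    obtain ⟨h1, h2, h3, h4⟩ := tr_top t z N M B hN hM k i (by omega)
    rw [hN i (by omega), hM i (by omega)]
    refine ⟨fun _ => ⟨?_, ?_⟩, ?_, ?_⟩
    · simp [h1, h2, h3]
    · rw [zero_add, h2, h3, h4]
      exact ⟨- (z * (1 - t)), by ring⟩
    · simp
    · simp
  | succ j ih =>
    intro i hi
    have h := ih (i + 1) (by omega)
    refine inv_step t z _ N M i (hN' i) (hM' i) _ _ _ _ h ?_ ?_
    · intro a
      rw [show j + 1 + k = (j + k) + 1 by ring]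
      rfl
    · intro a
      rw [show j + 1 + k = (j + k) + 1 by ring]
      rfl
end PartB

section PartC

section partC
variable {K : Type} [Field K]

def phiI {p : ℕ} (t : K) (l ν : Fin p → ℤ) : K := if interQ ν l then phiHL t l ν else 0
def psiI {p : ℕ} (t : K) (l : Fin (p + 1) → ℤ) (μ : Fin p → ℤ) : K :=
  if interP μ l then psiHL t l μ else 0

lemma mcount_out {p : ℕ} {A : ℤ} {J : ℕ} {l : Fin p → ℤ} (h : InBox A J l) {c : ℤ}
    (hc : c < A ∨ A + J ≤ c) : mcount l c = 0 := by
  unfold mcount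
  rw [Finset.filter_false_of_mem]
  · simp
  · intro j _
    have := h j
    omega

lemma finprod_range {A : ℤ} {J : ℕ} (g : ℤ → K) (hg : ∀ c, c < A ∨ A + J ≤ c → g c = 1) :
    ∏ᶠ c, g c = ∏ i : Fin J, g (A + i) := by
  rw [finprod_eq_prod_of_mulSupport_subset (s := Finset.univ.image fun i : Fin J => A + (i : ℤ))]
  · rw [Finset.prod_image]
    intro i _ j _ h
    ext
    simpa using h
  · intro c hc
    simp only [Finset.coe_image, Finset.coe_univ, Set.image_univ, Set.mem_range]
    by_contra hn
    apply hc
    apply hg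
    by_contra hh
    push Not at hh
    exact hn ⟨⟨(c - A).toNat, by omega⟩, by simp; omega⟩

lemma reindex (q : ℕ) (A : ℤ) (J : ℕ) (N0 : ℕ → ℤ) (g : (Fin q → ℤ) → K)
    (w : (Fin (J + 1) → Fin 2) → K)
    (h1 : ∀ l, g l ≠ 0 → IsSig l ∧ InBox A J l ∧
      ∀ i ≤ J, N0 i ≤ cnt l (A + i) ∧ cnt l (A + i) ≤ N0 i + 1)
    (h2 : ∀ l, IsSig l → InBox A J l → ∀ f : Fin (J + 1) → Fin 2,
      (∀ i : Fin (J + 1), (cnt l (A + (i : ℕ)) : ℤ) = N0 i + (f i : ℕ)) → g l = w f)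
    (h3 : ∀ f, w f ≠ 0 → N0 0 + (f 0 : ℕ) = q ∧ N0 J + (f (Fin.last J) : ℕ) = 0 ∧
      ∀ i : Fin J, N0 (i + 1) + (f i.succ : ℕ) ≤ N0 i + (f i.castSucc : ℕ)) :
    ∑ᶠ l, g l = ∑ f, w f := by
  let s : Finset (Fin q → ℤ) := Finset.Icc (fun _ => A) (fun _ => A + J)
  have hs : ∀ l, InBox A J l → l ∈ s := by
    intro l hl
    simp only [s, Finset.mem_Icc]
    exact ⟨fun i => (hl i).1, fun i => (hl i).2.le⟩
  rw [finsum_eq_sum_of_support_subset (s := s)]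
  swap
  · intro l hl
    exact hs l (h1 l hl).2.1
  let pth : (Fin q → ℤ) → Fin (J + 1) → Fin 2 := fun l i =>
    if (cnt l (A + (i : ℕ)) : ℤ) = N0 i then 0 else 1
  have hp : ∀ l, g l ≠ 0 → ∀ i : Fin (J + 1), (cnt l (A + (i : ℕ)) : ℤ) = N0 i + (pth l i : ℕ) := by
    intro l hl i
    have := (h1 l hl).2.2 i (by omega)
    simp only [pth]
    split_ifs with h
    · simp [h]
    · simp; omega
  refine Finset.sum_bij_ne_zero (fun l _ _ => pth l) ?_ ?_ ?_ ?_
  · simp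
  · intro l _ hl l' _ hl' he
    apply sig_ext (h1 l hl).1 (h1 l' hl').1
    intro c
    rcases lt_or_ge c A with h | h
    · rw [cnt_low (h1 l hl).2.1 h.le, cnt_low (h1 l' hl').2.1 h.le]
    rcases lt_or_ge (A + J) c with h' | h'
    · rw [cnt_high (h1 l hl).2.1 h'.le, cnt_high (h1 l' hl').2.1 h'.le]
    have e1 := hp l hl ⟨(c - A).toNat, by omega⟩
    have e2 := hp l' hl' ⟨(c - A).toNat, by omega⟩
    have ec : A + ((c - A).toNat : ℤ) = c := by omega
    simp only [ec] at e1 e2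
    rw [he] at e1
    have : (cnt l c : ℤ) = cnt l' c := by rw [e1, e2]
    exact_mod_cast this
  · intro f _ hf
    obtain ⟨f0, fJ, fm⟩ := h3 f hf
    let L : ℕ → ℤ := fun i => if h : i < J + 1 then N0 i + (f ⟨i, h⟩ : ℕ) else 0
    have hLi : ∀ i : Fin (J + 1), L i = N0 i + (f i : ℕ) := by
      intro i
      simp only [L]
      rw [dif_pos i.2]
    obtain ⟨l, hl1, hl2, hl3⟩ := exists_sig q A J L
      (by have := hLi 0; simp only [Fin.val_zero] at this; rw [this, f0])
      (by have := hLi (Fin.last J); simp only [Fin.val_last] at this; rw [this, fJ])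
      (by
        intro i hi
        have e1 := hLi (Fin.castSucc ⟨i, hi⟩)
        have e2 := hLi (Fin.succ ⟨i, hi⟩)
        have e3 := fm ⟨i, hi⟩
        simp only [Fin.val_castSucc, Fin.val_succ] at e1 e2 e3
        rw [e1, e2]
        exact e3)
    have hl4 : ∀ i : Fin (J + 1), (cnt l (A + (i : ℕ)) : ℤ) = N0 i + (f i : ℕ) := by
      intro i
      rw [hl3 i (by omega), hLi]
    have hgl : g l ≠ 0 := by rw [h2 l hl1 hl2 f hl4]; exact hf
    refine ⟨l, hs l hl2, hgl, ?_⟩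
    funext i
    have e1 := hp l hgl i
    have e2 := hl4 i
    ext
    omega
  · intro l _ hl
    exact h2 l (h1 l hl).1 (h1 l hl).2.1 _ (hp l hl)

lemma lw_ne_zero {R : Type} [CommRing R] (t : R) (N M : ℕ → ℤ) (i : ℕ) (hN : N (i+1) ≤ N i)
    (hM : M (i+1) ≤ M i) (a b : Fin 2) (h : lw t N M i a b ≠ 0) :
    N (i+1) + (b : ℕ) ≤ N i + (a : ℕ) := by
  by_contra hn
  apply h
  unfold lw
  have ha := a.2
  have hb := b.2
  split_ifs with h1 h2 h3 h3
  · omega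
  · omega
  · have : (M i - M (i+1)).toNat = 0 := by omega
    simp [this]
  · omega
  · rfl

lemma lw_valid {R : Type} [CommRing R] (t : R) (N M : ℕ → ℤ) (i : ℕ) (a b : Fin 2)
    (h : lw t N M i a b ≠ 0) : 0 ≤ (a : ℤ) + (N i - M i) ∧ (a : ℤ) + (N i - M i) ≤ 1 := by
  by_contra hn
  apply h
  unfold lw
  rw [if_neg]
  tauto

lemma lw_map {R S : Type} [CommRing R] [CommRing S] (φ : R →+* S) (t : R) (N M : ℕ → ℤ) (i : ℕ)
    (a b : Fin 2) : lw (φ t) N M i a b = φ (lw t N M i a b) := by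
  unfold lw
  split_ifs <;> simp

lemma cnt_anti {p : ℕ} (l : Fin p → ℤ) (c : ℤ) : cnt l (c + 1) ≤ cnt l c := by
  have := cnt_eq_add l c
  omega

lemma ite_one_congr {P Q : Prop} [Decidable P] [Decidable Q] {x y : K} (h : P ↔ Q)
    (hxy : P → x = y) : (if P then x else 1) = if Q then y else 1 := by
  by_cases hp : P
  · rw [if_pos hp, if_pos (h.1 hp), hxy hp]
  · rw [if_neg hp, if_neg (fun hq => hp (h.2 hq))]

lemma prodS {n : ℕ} (t : K) {A : ℤ} {J : ℕ} {ν l : Fin (n + 1) → ℤ} {μ : Fin n → ℤ}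
    (hν : InBox A J ν) (hl : InBox A J l) (hμ : InBox A J μ) (N M : ℕ → ℤ)
    (hN : ∀ i : ℕ, N i = cnt ν (A + i)) (hM : ∀ i : ℕ, M i = cnt μ (A + i))
    (f : Fin (J + 1) → Fin 2)
    (hf : ∀ i : Fin (J + 1), (cnt l (A + (i : ℕ)) : ℤ) = N i + (f i : ℕ))
    (hv : ∀ i : Fin (J + 1), 0 ≤ ((f i : ℕ) : ℤ) + (N i - M i) ∧ ((f i : ℕ) : ℤ) + (N i - M i) ≤ 1) :
    phiHL t l ν * psiHL t l μ = ∏ i : Fin J, lw t N M i (f i.castSucc) (f i.succ) := by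
  unfold phiHL psiHL
  rw [finprod_range (A := A) (J := J), finprod_range (A := A) (J := J), ← Finset.prod_mul_distrib]
  · apply Finset.prod_congr rfl
    intro i _
    have v1 := hv i.castSucc
    have v2 := hv i.succ
    have f1 := hf i.castSucc
    have f2 := hf i.succ
    simp only [Fin.val_castSucc, Fin.val_succ] at v1 v2 f1 f2
    unfold lw
    rw [if_pos (And.intro v1 v2)]
    have c1 := cnt_eq_add l (A + i)
    have c2 := cnt_eq_add ν (A + i)
    have c3 := cnt_eq_add μ (A + i)
    have n1 := hN i
    have n2 := hN (i + 1)
    have m1 := hM i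
    have m2 := hM (i + 1)
    push_cast at n2 m2 f2
    rw [← add_assoc] at n2 m2 f2
    have a2 := (f i.castSucc).2
    have b2 := (f i.succ).2
    have ea : f i.castSucc = 1 ↔ (f i.castSucc : ℕ) = 1 := by rw [Fin.ext_iff]; rfl
    have eb : f i.succ = 0 ↔ (f i.succ : ℕ) = 0 := by rw [Fin.ext_iff]; rfl
    congr 1
    · apply ite_one_congr
      · rw [ea, eb]
        omega
      · intro h
        congr 2
        omega
    · apply ite_one_congr
      · omega
      · intro h
        congr 2
        omega
  · intro c hc
    simp [mcount_out hl hc, mcount_out hμ hc]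
  · intro c hc
    simp [mcount_out hl hc, mcount_out hν hc]

lemma prodT {n : ℕ} (t : K) {A : ℤ} {J : ℕ} {ν : Fin (n + 1) → ℤ} {κ μ : Fin n → ℤ}
    (hν : InBox A J ν) (hκ : InBox A J κ) (hμ : InBox A J μ) (N M : ℕ → ℤ)
    (hN : ∀ i : ℕ, N i = cnt ν (A + i)) (hM : ∀ i : ℕ, M i = cnt μ (A + i))
    (f : Fin (J + 1) → Fin 2)
    (hf : ∀ i : Fin (J + 1), (cnt κ (A + (i : ℕ)) : ℤ) = N i - 1 + (f i : ℕ))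
    (hv : ∀ i : Fin (J + 1), 0 ≤ ((f i : ℕ) : ℤ) + (N i - M i) ∧ ((f i : ℕ) : ℤ) + (N i - M i) ≤ 1) :
    psiHL t ν κ * phiHL t μ κ = ∏ i : Fin J, lw t N M i (f i.castSucc) (f i.succ) := by
  unfold phiHL psiHL
  rw [finprod_range (A := A) (J := J), finprod_range (A := A) (J := J), ← Finset.prod_mul_distrib]
  · apply Finset.prod_congr rfl
    intro i _
    have v1 := hv i.castSucc
    have v2 := hv i.succ
    have f1 := hf i.castSucc
    have f2 := hf i.succ
    simp only [Fin.val_castSucc, Fin.val_succ] at v1 v2 f1 f2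
    unfold lw
    rw [if_pos (And.intro v1 v2)]
    have c1 := cnt_eq_add κ (A + i)
    have c2 := cnt_eq_add ν (A + i)
    have c3 := cnt_eq_add μ (A + i)
    have n1 := hN i
    have n2 := hN (i + 1)
    have m1 := hM i
    have m2 := hM (i + 1)
    push_cast at n2 m2 f2
    rw [← add_assoc] at n2 m2 f2
    have a2 := (f i.castSucc).2
    have b2 := (f i.succ).2
    have ea : f i.castSucc = 1 ↔ (f i.castSucc : ℕ) = 1 := by rw [Fin.ext_iff]; rfl
    have eb : f i.succ = 0 ↔ (f i.succ : ℕ) = 0 := by rw [Fin.ext_iff]; rfl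
    congr 1
    · apply ite_one_congr
      · rw [ea, eb]
        omega
      · intro h
        congr 2
        omega
    · apply ite_one_congr
      · omega
      · intro h
        congr 2
        omega
  · intro c hc
    simp [mcount_out hκ hc, mcount_out hμ hc]
  · intro c hc
    simp [mcount_out hκ hc, mcount_out hν hc]

end partC
end PartC

section PartD

section partD
variable {K : Type} [Field K]

def FF {n : ℕ} (t : K) (ν : Fin (n + 1) → ℤ) (μ : Fin n → ℤ) (d : ℕ) : K :=
  ∑ᶠ l : Fin (n + 1) → ℤ, if sumz l = sumz ν + d then phiI t l ν * psiI t l μ else 0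
def GG {n : ℕ} (t : K) (ν : Fin (n + 1) → ℤ) (μ : Fin n → ℤ) (d : ℕ) : K :=
  ∑ᶠ κ : Fin n → ℤ, if sumz κ = sumz μ - d then psiI t ν κ * phiI t μ κ else 0

open PowerSeries in
lemma coeff_tr (t : K) (N M : ℕ → ℤ) (ex : ℕ → Fin 2 → ℕ) (u : Fin 2) (U : Fin 2 → PowerSeries K)
    (hU : ∀ a, U a = if a = u then 1 else 0) (J d : ℕ) :
    PowerSeries.coeff d (tr (fun i a b => (X : PowerSeries K) ^ (ex i a) * lw (C t) N M i a b) U J 0 0)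
     = ∑ f : Fin (J + 1) → Fin 2,
      if (f 0 = 0 ∧ f (Fin.last J) = u) ∧ ∑ i : Fin J, ex i (f i.castSucc) = d then
        ∏ i : Fin J, lw t N M i (f i.castSucc) (f i.succ) else 0 := by
  rw [tr_eq_sum, map_sum]
  apply Finset.sum_congr rfl
  intro f _
  by_cases h0 : f 0 = 0
  · by_cases h1 : f (Fin.last J) = u
    · simp only [h0, h1, if_true, true_and, hU, mul_one, zero_add]
      rw [Finset.prod_mul_distrib, Finset.prod_pow_eq_pow_sum]
      simp only [lw_map]
      rw [← map_prod, mul_comm, coeff_C_mul, coeff_X_pow]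
      simp only [eq_comm (a := d)]
      split_ifs <;> simp
    · simp [h1, hU]
  · simp [h0]

lemma le_of_sumz {p : ℕ} {ν l : Fin p → ℤ} (h : ∀ i, ν i ≤ l i) {d : ℤ} (hd : sumz l = sumz ν + d)
    (i : Fin p) : l i ≤ ν i + d := by
  have h1 : ∑ j, (l j - ν j) = d := by
    unfold sumz at hd
    rw [Finset.sum_sub_distrib]; omega
  have := Finset.single_le_sum (f := fun j => l j - ν j) (fun j _ => by have := h j; simp; omega)
    (Finset.mem_univ i)
  omega

lemma FF_eq {n : ℕ} (t : K) {ν : Fin (n + 1) → ℤ} {μ : Fin n → ℤ} (hνs : IsSig ν) (hμs : IsSig μ)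
    {A : ℤ} {B k d : ℕ} (hν : InBox A B ν) (hμ : InBox A B μ) (hd : d ≤ k) (N M : ℕ → ℤ)
    (hN : ∀ i : ℕ, N i = cnt ν (A + i)) (hM : ∀ i : ℕ, M i = cnt μ (A + i)) :
    FF t ν μ d = PowerSeries.coeff d
      (tr (WS (PowerSeries.C t) PowerSeries.X N M) (uS (PowerSeries K)) (B + k) 0 0) := by
  have hν' : InBox A (B + k) ν := fun i => by have := hν i; push_cast; omega
  have hμ' : InBox A (B + k) μ := fun i => by have := hμ i; push_cast; omega
  have := coeff_tr t N M (fun _ a => a) 0 (uS (PowerSeries K))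
    (by intro a; fin_cases a <;> simp [uS]) (B + k) d
  refine Eq.trans ?_ this.symm
  unfold FF
  apply reindex _ A (B + k) N
  · intro l hl
    split_ifs at hl with h1
    swap
    · simp at hl
    unfold phiI psiI at hl
    split_ifs at hl with h2 h3 h3 <;> try (simp at hl; done)
    have hls := (sig_of_interQ h2).2
    refine ⟨hls, ?_, ?_⟩
    · intro i
      have e1 := h2.1 i
      have e2 := le_of_sumz h2.1 h1 i
      have e3 := hν i
      push_cast
      omega
    · intro i _
      have := (interQ_iff hνs hls).1 h2 (A + i)
      rw [hN]
      omega
  · intro l hls hl f hf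
    have f0 : f 0 = 0 := by
      have := hf 0
      simp only [Fin.val_zero, hN] at this
      rw [cnt_low hl (by simp), cnt_low hν' (by simp)] at this
      ext
      simp
      omega
    have fl : f (Fin.last _) = 0 := by
      have := hf (Fin.last _)
      simp only [Fin.val_last, hN] at this
      rw [cnt_high hl (by simp), cnt_high hν' (by simp)] at this
      ext
      simp
      omega
    have hsum : sumz l = sumz ν + d ↔ ∑ i : Fin (B + k), ((f i.castSucc : Fin 2) : ℕ) = d := by
      have e1 := sum_cnt hl
      have e2 := sum_cnt hν'
      rw [← Fin.sum_univ_eq_sum_range (fun i => (cnt l (A + (i : ℕ)) : ℤ))] at e1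
      rw [← Fin.sum_univ_eq_sum_range (fun i => (cnt ν (A + (i : ℕ)) : ℤ))] at e2
      have e3 : ∑ i : Fin (B + k), (cnt l (A + (i : ℕ)) : ℤ) =
          ∑ i : Fin (B + k), (cnt ν (A + (i : ℕ)) : ℤ) +
            ((∑ i : Fin (B + k), ((f i.castSucc : Fin 2) : ℕ) : ℕ) : ℤ) := by
        push_cast
        rw [← Finset.sum_add_distrib]
        apply Finset.sum_congr rfl
        intro i _
        have := hf i.castSucc
        rw [hN] at this
        simpa using this
      omega
    rw [if_congr (show _ ↔ ((f 0 = 0 ∧ f (Fin.last _) = 0) ∧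
      ∑ i : Fin (B + k), ((f i.castSucc : Fin 2) : ℕ) = d) by rw [hsum]; tauto) rfl rfl]
    congr 1
    have hQ : interQ ν l := by
      rw [interQ_iff hνs hls]
      intro c
      rcases lt_or_ge c A with h | h
      · rw [cnt_low hl h.le, cnt_low hν' h.le]; omega
      rcases lt_or_ge (A + (B + k : ℕ)) c with h' | h'
      · rw [cnt_high hl h'.le, cnt_high hν' h'.le]; omega
      have e1 := hf ⟨(c - A).toNat, by omega⟩
      have ec : A + ((c - A).toNat : ℤ) = c := by omega
      simp only [hN, ec] at e1
      have := (f ⟨(c - A).toNat, by omega⟩).2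
      omega
    unfold phiI psiI
    rw [if_pos hQ]
    split_ifs with hP
    · apply prodS t hν' hl hμ' N M hN hM f hf
      intro i
      have := (interP_iff hμs hls).1 hP (A + (i : ℕ))
      have e := hf i
      rw [hM]
      omega
    · by_contra hne
      apply hP
      rw [interP_iff hμs hls]
      intro c
      rcases lt_or_ge c A with h | h
      · rw [cnt_low hl h.le, cnt_low hμ' h.le]; omega
      rcases le_or_gt (A + (B + k : ℕ)) c with h' | h'
      · rw [cnt_high hl h', cnt_high hμ' h']; omega
      have hne' : ∏ i : Fin (B + k), lw t N M i (f i.castSucc) (f i.succ) ≠ 0 := by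
        intro h0; apply hne; rw [h0]; simp
      rw [Finset.prod_ne_zero_iff] at hne'
      have e0 := lw_valid _ _ _ _ _ _ (hne' ⟨(c - A).toNat, by omega⟩ (Finset.mem_univ _))
      have e1 := hf (Fin.castSucc ⟨(c - A).toNat, by omega⟩)
      have ec : A + ((c - A).toNat : ℤ) = c := by omega
      simp only [hN, hM, ec, Fin.val_castSucc] at e1 e0
      omega
  · intro f hf
    split_ifs at hf with h
    swap
    · simp at hf
    rw [Finset.prod_ne_zero_iff] at hf
    refine ⟨?_, ?_, ?_⟩
    · rw [h.1.1, hN, cnt_low hν' (by simp)]; simp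
    · rw [h.1.2, hN, cnt_high hν' (by simp)]; simp
    · intro i
      apply lw_ne_zero t N M i _ _ _ _ (hf i (Finset.mem_univ _))
      · rw [hN, hN]; push_cast; rw [← add_assoc]; exact_mod_cast cnt_anti _ _
      · rw [hM, hM]; push_cast; rw [← add_assoc]; exact_mod_cast cnt_anti _ _

lemma GG_eq {n : ℕ} (t : K) {ν : Fin (n + 1) → ℤ} {μ : Fin n → ℤ} (hνs : IsSig ν) (hμs : IsSig μ)
    {A : ℤ} {J d : ℕ} (hν' : InBox A J ν) (hμ' : InBox A J μ) (N M : ℕ → ℤ)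
    (hN : ∀ i : ℕ, N i = cnt ν (A + i)) (hM : ∀ i : ℕ, M i = cnt μ (A + i)) :
    GG t ν μ d = PowerSeries.coeff d
      (tr (WT (PowerSeries.C t) PowerSeries.X N M) (uT (PowerSeries K)) J 0 0) := by
  have := coeff_tr t N M (fun i a => (1 - (N i - M i) - (a : ℕ)).toNat) 1 (uT (PowerSeries K))
    (by intro a; fin_cases a <;> simp [uT]) J d
  refine Eq.trans ?_ this.symm
  unfold GG
  apply reindex _ A J (fun i => N i - 1)
  · intro κ hl
    split_ifs at hl with h1
    swap
    · simp at hl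
    unfold phiI psiI at hl
    split_ifs at hl with h2 h3 h3 <;> try (simp at hl; done)
    have hls := (sig_of_interP h2).1
    refine ⟨hls, ?_, ?_⟩
    · intro i
      have e1 := (h2 i).2
      have e2 := h3.1 i
      have e3 := hν' i.succ
      have e4 := hμ' i
      omega
    · intro i _
      have := (interP_iff hls hνs).1 h2 (A + i)
      simp only [hN]
      omega
  · intro κ hls hl f hf
    have f0 : f 0 = 0 := by
      have := hf 0
      simp only [Fin.val_zero, hN] at this
      rw [cnt_low hl (by simp), cnt_low hν' (by simp)] at this
      ext
      simp
      push_cast at this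
      omega
    have fl : f (Fin.last _) = 1 := by
      have := hf (Fin.last _)
      simp only [Fin.val_last, hN] at this
      rw [cnt_high hl (by simp), cnt_high hν' (by simp)] at this
      ext
      simp
      push_cast at this
      omega
    have hP : interP κ ν := by
      rw [interP_iff hls hνs]
      intro c
      rcases lt_or_ge c A with h | h
      · rw [cnt_low hl h.le, cnt_low hν' h.le]; omega
      rcases lt_or_ge (A + (J : ℕ)) c with h' | h'
      · rw [cnt_high hl h'.le, cnt_high hν' h'.le]; omega
      have e1 := hf ⟨(c - A).toNat, by omega⟩
      have ec : A + ((c - A).toNat : ℤ) = c := by omega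
      simp only [hN, ec] at e1
      have := (f ⟨(c - A).toNat, by omega⟩).2
      omega
    unfold phiI psiI
    rw [if_pos hP]
    by_cases hQ : interQ κ μ
    · rw [if_pos hQ]
      have hv : ∀ i : Fin (J + 1), 0 ≤ ((f i : ℕ) : ℤ) + (N i - M i) ∧
          ((f i : ℕ) : ℤ) + (N i - M i) ≤ 1 := by
        intro i
        have := (interQ_iff hls hμs).1 hQ (A + (i : ℕ))
        have e := hf i
        rw [hM]
        omega
      have hsum : sumz κ = sumz μ - d ↔
          ∑ i : Fin J, (1 - (N i - M i) - ((f i.castSucc : Fin 2) : ℕ)).toNat = d := by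
        have e1 := sum_cnt hl
        have e2 := sum_cnt hμ'
        rw [← Fin.sum_univ_eq_sum_range (fun i => (cnt κ (A + (i : ℕ)) : ℤ))] at e1
        rw [← Fin.sum_univ_eq_sum_range (fun i => (cnt μ (A + (i : ℕ)) : ℤ))] at e2
        have e3 : ∑ i : Fin J, (cnt μ (A + (i : ℕ)) : ℤ) =
            ∑ i : Fin J, (cnt κ (A + (i : ℕ)) : ℤ) +
            ((∑ i : Fin J, (1 - (N i - M i) - ((f i.castSucc : Fin 2) : ℕ)).toNat : ℕ) : ℤ) := by
          push_cast
          rw [← Finset.sum_add_distrib]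
          apply Finset.sum_congr rfl
          intro i _
          have e1 := hf i.castSucc
          have e2 := hv i.castSucc
          simp only [Fin.val_castSucc] at e1 e2
          have e3 := hM i
          omega
        omega
      rw [if_congr (show _ ↔ ((f 0 = 0 ∧ f (Fin.last _) = 1) ∧
        ∑ i : Fin J, (1 - (N i - M i) - ((f i.castSucc : Fin 2) : ℕ)).toNat = d) by
          rw [hsum]; tauto) rfl rfl]
      congr 1
      exact prodT t hν' hl hμ' N M hN hM f hf hv
    · rw [if_neg hQ]
      have : ∏ i : Fin J, lw t N M i (f i.castSucc) (f i.succ) = 0 := by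
        by_contra hne'
        apply hQ
        rw [interQ_iff hls hμs]
        intro c
        rcases lt_or_ge c A with h | h
        · rw [cnt_low hl h.le, cnt_low hμ' h.le]; omega
        rcases le_or_gt (A + (J : ℕ)) c with h' | h'
        · rw [cnt_high hl h', cnt_high hμ' h']; omega
        rw [← ne_eq, Finset.prod_ne_zero_iff] at hne'
        have e0 := lw_valid _ _ _ _ _ _ (hne' ⟨(c - A).toNat, by omega⟩ (Finset.mem_univ _))
        have e1 := hf (Fin.castSucc ⟨(c - A).toNat, by omega⟩)
        have ec : A + ((c - A).toNat : ℤ) = c := by omega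
        simp only [hN, hM, ec, Fin.val_castSucc] at e1 e0
        omega
      rw [this]
      simp
  · intro f hf
    split_ifs at hf with h
    swap
    · simp at hf
    rw [Finset.prod_ne_zero_iff] at hf
    refine ⟨?_, ?_, ?_⟩
    · rw [h.1.1, hN, cnt_low hν' (by simp)]; simp
    · rw [h.1.2, hN, cnt_high hν' (by simp)]; simp
    · intro i
      have := lw_ne_zero t N M i ?_ ?_ _ _ (hf i (Finset.mem_univ _))
      · linarith
      · rw [hN, hN]; push_cast; rw [← add_assoc]; exact_mod_cast cnt_anti _ _
      · rw [hM, hM]; push_cast; rw [← add_assoc]; exact_mod_cast cnt_anti _ _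

lemma exists_box {n m : ℕ} (ν : Fin n → ℤ) (μ : Fin m → ℤ) :
    ∃ (A : ℤ) (B : ℕ), InBox A B ν ∧ InBox A B μ := by
  let s : ℕ := ∑ i, (ν i).natAbs + ∑ i, (μ i).natAbs
  have h1 : ∀ i, (ν i).natAbs ≤ s := fun i =>
    (Finset.single_le_sum (f := fun i => (ν i).natAbs) (fun _ _ => Nat.zero_le _)
      (Finset.mem_univ i)).trans (Nat.le_add_right _ _)
  have h2 : ∀ i, (μ i).natAbs ≤ s := fun i =>
    (Finset.single_le_sum (f := fun i => (μ i).natAbs) (fun _ _ => Nat.zero_le _)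
      (Finset.mem_univ i)).trans (Nat.le_add_left _ _)
  refine ⟨-s, 2 * s + 1, fun i => ?_, fun i => ?_⟩
  · have := h1 i
    push_cast
    omega
  · have := h2 i
    push_cast
    omega

open PowerSeries in
lemma core {n : ℕ} (t : K) {ν : Fin (n + 1) → ℤ} {μ : Fin n → ℤ} (hνs : IsSig ν) (hμs : IsSig μ) :
    FF t ν μ 0 = GG t ν μ 0 ∧
    ∀ d, FF t ν μ (d + 1) - FF t ν μ d = GG t ν μ (d + 1) - t * GG t ν μ d := by
  obtain ⟨A, B, hν, hμ⟩ := exists_box ν μ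
  have key : ∀ k : ℕ, (X : PowerSeries K) ^ k ∣
      (1 - X) * (tr (WS (C t) X (fun i => cnt ν (A + i)) (fun i => cnt μ (A + i)))
        (uS (PowerSeries K)) (B + k) 0 0) -
      (1 - C t * X) * (tr (WT (C t) X (fun i => cnt ν (A + i)) (fun i => cnt μ (A + i)))
        (uT (PowerSeries K)) (B + k) 0 0) := by
    intro k
    have := tr_main (C t) (X : PowerSeries K) (fun i => cnt ν (A + i)) (fun i => cnt μ (A + i)) B k
      (by intro i hi; rw [cnt_high hν (by simpa using hi)]; rfl)
      (by intro i hi; rw [cnt_high hμ (by simpa using hi)]; rfl)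
      (by intro i; push_cast; rw [← add_assoc]; exact_mod_cast cnt_anti _ _)
      (by intro i; push_cast; rw [← add_assoc]; exact_mod_cast cnt_anti _ _) B 0 (by simp)
    refine this.2.1 ?_
    rw [cnt_low hν (by simp), cnt_low hμ (by simp)]
    simp
  have box : ∀ (k m : ℕ) (l : Fin m → ℤ), InBox A B l → InBox A (B + k : ℕ) l := by
    intro k m l h i
    have := h i; push_cast; omega
  have hF : ∀ k d, d ≤ k → _ := fun k d hd => FF_eq (d := d) (k := k) t hνs hμs hν hμ hd
    (fun i => cnt ν (A + i)) (fun i => cnt μ (A + i)) (fun _ => rfl) (fun _ => rfl)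
  have hG : ∀ k d, _ := fun k d => GG_eq (J := B + k) (d := d) t hνs hμs (box _ _ _ hν)
    (box _ _ _ hμ) (fun i => cnt ν (A + i)) (fun i => cnt μ (A + i)) (fun _ => rfl) (fun _ => rfl)
  constructor
  · have := (X_pow_dvd_iff.1 (key 1)) 0 (by simp)
    rw [hF 1 0 (by simp), hG 1 0]
    rw [sub_mul, sub_mul, one_mul, one_mul, mul_assoc] at this
    simp only [map_sub, coeff_C_mul, coeff_zero_X_mul] at this
    linear_combination this
  · intro d
    have := (X_pow_dvd_iff.1 (key (d + 2))) (d + 1) (by simp)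
    rw [hF (d + 2) (d + 1) (by omega), hF (d + 2) d (by omega), hG (d + 2) (d + 1), hG (d + 2) d]
    rw [sub_mul, sub_mul, one_mul, one_mul, mul_assoc] at this
    simp only [map_sub, coeff_C_mul, coeff_succ_X_mul] at this
    linear_combination this

end partD
end PartD

section PartE

section partE
variable {K : Type} [Field K]

def PP (t : K) : (n : ℕ) → (Fin n → ℤ) → (Fin n → K) → K
  | 0, _, _ => 1
  | n + 1, l, x => ∑ᶠ μ : Fin n → ℤ,
      psiI t l μ * x (Fin.last n) ^ (sumz l - sumz μ) * PP t n μ (fun i => x i.castSucc)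

def qq (t : K) {n : ℕ} (ν : Fin n → ℤ) (x : Fin n → K) (d : ℕ) : K :=
  ∑ᶠ l : Fin n → ℤ, if sumz l = sumz ν + d then phiI t l ν * PP t n l x else 0

def bx (p : ℕ) (A B : ℤ) : Finset (Fin p → ℤ) := Finset.Icc (fun _ => A) (fun _ => B)

lemma mem_bx {p : ℕ} {A B : ℤ} {l : Fin p → ℤ} : l ∈ bx p A B ↔ ∀ i, A ≤ l i ∧ l i ≤ B := by
  unfold bx
  rw [Finset.mem_Icc, Pi.le_def, Pi.le_def]
  exact forall_and.symm

lemma finsum_bx {p : ℕ} (f : (Fin p → ℤ) → K) (A B : ℤ)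
    (h : ∀ l, f l ≠ 0 → ∀ i, A ≤ l i ∧ l i ≤ B) : ∑ᶠ l, f l = ∑ l ∈ bx p A B, f l := by
  apply finsum_eq_sum_of_support_subset
  intro l hl
  simpa [mem_bx] using h l hl

lemma psiI_ne {n : ℕ} {t : K} {l : Fin (n + 1) → ℤ} {μ : Fin n → ℤ} (h : psiI t l μ ≠ 0) :
    interP μ l := by
  unfold psiI at h
  by_contra h'
  simp [h'] at h

lemma phiI_ne {n : ℕ} {t : K} {l ν : Fin n → ℤ} (h : phiI t l ν ≠ 0) : interQ ν l := by
  unfold phiI at h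
  by_contra h'
  simp [h'] at h

lemma PP_sig (t : K) : ∀ {n : ℕ} {l : Fin n → ℤ} {x : Fin n → K}, PP t n l x ≠ 0 → IsSig l := by
  intro n l x h
  cases n with
  | zero => intro i; exact i.elim0
  | succ n =>
    unfold PP at h
    by_contra h'
    apply h
    apply finsum_eq_zero_of_forall_eq_zero
    intro μ
    by_cases h1 : psiI t l μ = 0
    · simp [h1]
    · exact absurd (sig_of_interP (psiI_ne h1)).2 h'

lemma interP_bd {n : ℕ} {l : Fin (n + 1) → ℤ} {μ : Fin n → ℤ} (h : interP μ l) {A B : ℤ}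
    (hl : ∀ i, A ≤ l i ∧ l i ≤ B) : ∀ i, A ≤ μ i ∧ μ i ≤ B := by
  intro i
  have := h i
  have h1 := hl i.castSucc
  have h2 := hl i.succ
  omega

lemma interQ_bd {n : ℕ} {l ν : Fin n → ℤ} (h : interQ ν l) {A B : ℤ} {d : ℕ}
    (hd : sumz l = sumz ν + d)
    (hl : ∀ i, A ≤ ν i ∧ ν i ≤ B) : ∀ i, A ≤ l i ∧ l i ≤ B + d := by
  intro i
  have := le_of_sumz h.1 hd i
  have h1 := hl i
  have := h.1 i
  omega

lemma PP_succ_bx (t : K) {n : ℕ} (l : Fin (n + 1) → ℤ) (x : Fin (n + 1) → K) {A B : ℤ}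
    (hl : ∀ i, A ≤ l i ∧ l i ≤ B) :
    PP t (n + 1) l x = ∑ μ ∈ bx n A B,
      psiI t l μ * x (Fin.last n) ^ (sumz l - sumz μ) * PP t n μ (fun i => x i.castSucc) := by
  rw [PP]
  apply finsum_bx
  intro μ h
  exact interP_bd (psiI_ne (left_ne_zero_of_mul (left_ne_zero_of_mul h))) hl

lemma qq_bx (t : K) {n : ℕ} (ν : Fin n → ℤ) (x : Fin n → K) (d : ℕ) {A B : ℤ}
    (hl : ∀ i, A ≤ ν i ∧ ν i + d ≤ B) :
    qq t ν x d = ∑ l ∈ bx n A B, if sumz l = sumz ν + d then phiI t l ν * PP t n l x else 0 := by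
  unfold qq
  apply finsum_bx
  intro l h i
  split_ifs at h with h1
  · have := interQ_bd (A := A) (B := B - d) (phiI_ne (left_ne_zero_of_mul h)) h1
      (fun i => by have := hl i; omega) i
    omega
  · simp at h

lemma qq_succ (t : K) {n : ℕ} (ν : Fin (n + 1) → ℤ) (x : Fin (n + 1) → K) (d : ℕ) {A B : ℤ}
    (hl : ∀ i, A ≤ ν i ∧ ν i + d ≤ B) :
    qq t ν x d = ∑ μ ∈ bx n A B, x (Fin.last n) ^ (sumz ν + d - sumz μ) *
      PP t n μ (fun i => x i.castSucc) * FF t ν μ d := by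
  rw [qq_bx t ν x d hl]
  have e1 : ∀ l ∈ bx (n + 1) A B,
      (if sumz l = sumz ν + d then phiI t l ν * PP t (n + 1) l x else 0) =
      ∑ μ ∈ bx n A B, x (Fin.last n) ^ (sumz ν + d - sumz μ) *
        PP t n μ (fun i => x i.castSucc) *
        (if sumz l = sumz ν + d then phiI t l ν * psiI t l μ else 0) := by
    intro l hl'
    split_ifs with h
    · rw [PP_succ_bx t l x (mem_bx.1 hl'), Finset.mul_sum]
      apply Finset.sum_congr rfl
      intro μ _
      rw [h]; ring
    · simp
  rw [Finset.sum_congr rfl e1, Finset.sum_comm]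
  apply Finset.sum_congr rfl
  intro μ _
  rw [← Finset.mul_sum]
  congr 1
  unfold FF
  symm
  apply finsum_bx
  intro l h i
  split_ifs at h with h1
  · have := interQ_bd (A := A) (B := B - d) (phiI_ne (left_ne_zero_of_mul h)) h1
      (fun i => by have := hl i; omega) i
    omega
  · simp at h

lemma rr_succ (t : K) {n : ℕ} (ν : Fin (n + 1) → ℤ) (x : Fin (n + 1) → K) (d : ℕ) {A B : ℤ}
    (hl : ∀ i, A ≤ ν i ∧ ν i + d ≤ B) :
    ∑ κ ∈ bx n A B, psiI t ν κ * x (Fin.last n) ^ (sumz ν - sumz κ) *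
        qq t κ (fun i => x i.castSucc) d
      = ∑ μ ∈ bx n A B, x (Fin.last n) ^ (sumz ν + d - sumz μ) *
      PP t n μ (fun i => x i.castSucc) * GG t ν μ d := by
  have e1 : ∀ κ ∈ bx n A B, psiI t ν κ * x (Fin.last n) ^ (sumz ν - sumz κ) *
        qq t κ (fun i => x i.castSucc) d = 
      ∑ μ ∈ bx n A B, x (Fin.last n) ^ (sumz ν + d - sumz μ) *
        PP t n μ (fun i => x i.castSucc) *
        (if sumz κ = sumz μ - d then psiI t ν κ * phiI t μ κ else 0) := by
    intro κ _
    by_cases h : psiI t ν κ = 0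
    · simp [h]
    have hb := interP_bd (A := A) (B := B - d) (psiI_ne h) (fun i => by have := hl i; omega)
    rw [qq_bx t κ _ d (A := A) (B := B) (fun i => by have := hb i; omega), Finset.mul_sum]
    apply Finset.sum_congr rfl
    intro μ _
    by_cases h2 : sumz μ = sumz κ + d
    · rw [if_pos h2, if_pos (by omega)]
      have : sumz ν - sumz κ = sumz ν + d - sumz μ := by omega
      rw [this]; ring
    · rw [if_neg h2, if_neg (by omega)]; simp
  rw [Finset.sum_congr rfl e1, Finset.sum_comm]
  apply Finset.sum_congr rfl
  intro μ _
  rw [← Finset.mul_sum]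
  congr 1
  unfold GG
  symm
  apply finsum_bx
  intro κ h i
  split_ifs at h with h1
  · have := interP_bd (A := A) (B := B - d) (psiI_ne (left_ne_zero_of_mul h))
      (fun i => by have := hl i; omega) i
    omega
  · simp at h

lemma exists_bd {p : ℕ} (ν : Fin p → ℤ) : ∃ A B : ℤ, ∀ i, A ≤ ν i ∧ ν i ≤ B := by
  obtain ⟨A, B, h, -⟩ := exists_box ν ν
  exact ⟨A, A + B, fun i => by have := h i; omega⟩

open PowerSeries in
lemma pieri (t : K) : ∀ {n : ℕ} (ν : Fin n → ℤ) (x : Fin n → K), IsSig ν → (∀ i, x i ≠ 0) →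
    (∏ i, (1 - C (t * x i) * (X : PowerSeries K))) * C (PP t n ν x)
      = (∏ i, (1 - C (x i) * (X : PowerSeries K))) * PowerSeries.mk (qq t ν x) := by
  intro n
  induction n with
  | zero =>
    intro ν x _ _
    simp only [Finset.univ_eq_empty, Finset.prod_empty, one_mul]
    ext d
    rw [coeff_mk]
    unfold qq PP
    have : ∀ l : Fin 0 → ℤ, l = default := fun l => Subsingleton.elim _ _
    rw [finsum_eq_single _ (default : Fin 0 → ℤ) (fun l h => absurd (this l) h)]
    have h1 : phiI t (default : Fin 0 → ℤ) ν = 1 := by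
      unfold phiI phiHL mcount interQ
      simp
    rw [h1]
    by_cases hd : d = 0
    · subst hd; simp [sumz]
    · rw [coeff_C, if_neg hd, if_neg]
      simp [sumz]; omega
  | succ n ih =>
    intro ν x hν hx
    have main : (1 - C (x (Fin.last n)) * (X : PowerSeries K)) * PowerSeries.mk (qq t ν x) =
      (1 - C (t * x (Fin.last n)) * (X : PowerSeries K)) *
        PowerSeries.mk (fun d => ∑ᶠ κ : Fin n → ℤ, psiI t ν κ * x (Fin.last n) ^ (sumz ν - sumz κ) *
        qq t κ (fun i => x i.castSucc) d) := by
      obtain ⟨A, B, hb⟩ := exists_bd ν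
      have hr : ∀ d d' : ℕ, d ≤ d' → (∑ᶠ κ : Fin n → ℤ, psiI t ν κ * x (Fin.last n) ^ (sumz ν - sumz κ) *
        qq t κ (fun i => x i.castSucc) d) = ∑ μ ∈ bx n A (B + d'), x (Fin.last n) ^ (sumz ν + d - sumz μ) *
      PP t n μ (fun i => x i.castSucc) * GG t ν μ d := by
        intro d d' hd
        rw [← rr_succ t ν x d (fun i => by have := hb i; omega)]
        apply finsum_bx
        intro κ h
        exact interP_bd (psiI_ne (left_ne_zero_of_mul (left_ne_zero_of_mul h))) 
          (fun i => by have := hb i; omega)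
      have hq : ∀ d d' : ℕ, d ≤ d' → qq t ν x d = ∑ μ ∈ bx n A (B + d'), x (Fin.last n) ^ (sumz ν + d - sumz μ) *
      PP t n μ (fun i => x i.castSucc) * FF t ν μ d := fun d d' hd =>
        qq_succ t ν x d (fun i => by have := hb i; omega)
      ext d
      rw [sub_mul, sub_mul, one_mul, one_mul, mul_assoc, mul_assoc, map_sub, map_sub,
        coeff_C_mul, coeff_C_mul]
      cases d with
      | zero =>
        simp only [coeff_zero_X_mul, mul_zero, sub_zero, coeff_mk]
        rw [hr 0 0 le_rfl, hq 0 0 le_rfl]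
        apply Finset.sum_congr rfl
        intro μ _
        by_cases h : PP t n μ (fun i => x i.castSucc) = 0
        · simp [h]
        · rw [(core t hν (PP_sig t h)).1]
      | succ d =>
        simp only [coeff_succ_X_mul, coeff_mk]
        rw [hr (d + 1) (d + 1) le_rfl, hq (d + 1) (d + 1) le_rfl, hr d (d + 1) (by omega),
          hq d (d + 1) (by omega), Finset.mul_sum, Finset.mul_sum, ← Finset.sum_sub_distrib,
          ← Finset.sum_sub_distrib]
        apply Finset.sum_congr rfl
        intro μ _
        by_cases h : PP t n μ (fun i => x i.castSucc) = 0
        · simp [h]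
        · have := (core t hν (PP_sig t h)).2 d
          have e : x (Fin.last n) ^ (sumz ν + (d + 1 : ℕ) - sumz μ)
            = x (Fin.last n) * x (Fin.last n) ^ (sumz ν + d - sumz μ) := by
            rw [← zpow_one_add₀ (hx _)]; congr 1; push_cast; ring
          rw [e]
          linear_combination (x (Fin.last n) * x (Fin.last n) ^ (sumz ν + d - sumz μ)) *
            PP t n μ (fun i => x i.castSucc) * this
    rw [Fin.prod_univ_castSucc, Fin.prod_univ_castSucc, mul_assoc (∏ i : Fin n, _) _ (PowerSeries.mk _),
      main]
    obtain ⟨A, B, hb⟩ := exists_bd ν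
    have e3 : PowerSeries.mk (fun d => ∑ᶠ κ : Fin n → ℤ, psiI t ν κ * x (Fin.last n) ^ (sumz ν - sumz κ) *
        qq t κ (fun i => x i.castSucc) d) = ∑ κ ∈ bx n A B, 
          C (psiI t ν κ * x (Fin.last n) ^ (sumz ν - sumz κ)) * PowerSeries.mk (qq t κ (fun i => x i.castSucc)) := by
      ext d
      rw [coeff_mk, map_sum]
      simp only [coeff_C_mul, coeff_mk]
      apply finsum_bx
      intro κ h
      exact interP_bd (psiI_ne (left_ne_zero_of_mul (left_ne_zero_of_mul h))) hb
    rw [e3, PP_succ_bx t ν x hb, map_sum, Finset.mul_sum, Finset.mul_sum, Finset.mul_sum]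
    apply Finset.sum_congr rfl
    intro κ _
    by_cases h : psiI t ν κ = 0
    · simp [h]
    · have := ih κ (fun i => x i.castSucc) (sig_of_interP (psiI_ne h)).1 (fun i => hx _)
      rw [map_mul C (psiI t ν κ * x (Fin.last n) ^ (sumz ν - sumz κ)) (PP t n κ _)]
      linear_combination (1 - C (t * x (Fin.last n)) * (X : PowerSeries K)) * C (psiI t ν κ * x (Fin.last n) ^ (sumz ν - sumz κ)) * this

end partE
end PartE

section PartF

section partF
variable {K : Type} [Field K]

open PowerSeries in
lemma pieri_rescale (t : K) {n : ℕ} (ν : Fin n → ℤ) (x : Fin n → K) (hν : IsSig ν)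
    (hx : ∀ i, x i ≠ 0) (y : K) :
    (∏ i, (1 - C (t * x i) * (C y * (X : PowerSeries K)))) * C (PP t n ν x)
      = (∏ i, (1 - C (x i) * (C y * (X : PowerSeries K)))) *
        PowerSeries.mk (fun d => y ^ d * qq t ν x d) := by
  have hC : ∀ a : K, rescale y (C a) = C a := by
    intro a
    ext d
    rw [coeff_rescale, coeff_C]
    split_ifs with h
    · simp [h]
    · simp
  have hX : rescale y (X : PowerSeries K) = C y * X := by
    ext d
    rw [coeff_rescale, coeff_C_mul, coeff_X]
    split_ifs with h
    · simp [h]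
    · simp
  have := congrArg (rescale y) (pieri t ν x hν hx)
  simp only [map_mul, map_prod, map_sub, map_one, hC, hX] at this
  rw [rescale_mk] at this
  simpa only [map_mul] using this

lemma HLQ_succ (t : K) {n : ℕ} (k : ℕ) (ν l : Fin n → ℤ) (c : Fin (k + 1) → K) :
    HLQ t (k + 1) ν l c = ∑ᶠ κ : Fin n → ℤ, phiI t l κ * c (Fin.last k) ^ (sumz l - sumz κ) *
      HLQ t k ν κ (fun i => c i.castSucc) := by
  rw [HLQ]
  apply finsum_congr
  intro κ
  unfold phiI
  split_ifs <;> simp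

lemma HLQ_supp (t : K) {n : ℕ} : ∀ (k : ℕ) (ν l : Fin n → ℤ) (c : Fin k → K), HLQ t k ν l c ≠ 0 →
    (∀ i, ν i ≤ l i) ∧ (IsSig ν → IsSig l) := by
  intro k
  induction k with
  | zero =>
    intro ν l c h
    unfold HLQ at h
    split_ifs at h with h1
    · subst h1; exact ⟨fun _ => le_rfl, id⟩
    · simp at h
  | succ k ih =>
    intro ν l c h
    rw [HLQ_succ] at h
    obtain ⟨κ, hκ⟩ : ∃ κ, phiI t l κ * c (Fin.last k) ^ (sumz l - sumz κ) *
      HLQ t k ν κ (fun i => c i.castSucc) ≠ 0 := by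
      by_contra h0
      push Not at h0
      exact h (finsum_eq_zero_of_forall_eq_zero h0)
    have h1 := ih ν κ _ (right_ne_zero_of_mul hκ)
    have h2 := phiI_ne (left_ne_zero_of_mul (left_ne_zero_of_mul hκ))
    exact ⟨fun i => (h1.1 i).trans (h2.1 i), fun _ => (sig_of_interQ h2).2⟩

def RR (t : K) {n : ℕ} (s : ℕ) (ν : Fin n → ℤ) (c : Fin s → K) (x : Fin n → K) (d : ℕ) : K :=
  ∑ᶠ l : Fin n → ℤ, if sumz l = sumz ν + d then HLQ t s ν l c * PP t n l x else 0

lemma RR_bx (t : K) {n : ℕ} (s : ℕ) (ν : Fin n → ℤ) (c : Fin s → K) (x : Fin n → K) (d : ℕ)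
    {A B : ℤ} (hb : ∀ i, A ≤ ν i ∧ ν i + d ≤ B) :
    RR t s ν c x d = ∑ l ∈ bx n A B, if sumz l = sumz ν + d then HLQ t s ν l c * PP t n l x else 0 := by
  unfold RR
  apply finsum_bx
  intro l h i
  split_ifs at h with h1
  · have h2 := (HLQ_supp t s ν l c (left_ne_zero_of_mul h)).1
    have h3 := le_of_sumz h2 h1 i
    have := hb i
    have := h2 i
    omega
  · simp at h

lemma sumz_mono {p : ℕ} {ν l : Fin p → ℤ} (h : ∀ i, ν i ≤ l i) : sumz ν ≤ sumz l :=
  Finset.sum_le_sum (fun i _ => h i)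

lemma coeff_mul_congr (D f g : PowerSeries K) (d : ℕ)
    (h : ∀ b ≤ d, PowerSeries.coeff b f = PowerSeries.coeff b g) :
    PowerSeries.coeff d (D * f) = PowerSeries.coeff d (D * g) := by
  rw [PowerSeries.coeff_mul, PowerSeries.coeff_mul]
  apply Finset.sum_congr rfl
  intro p hp
  rw [h p.2 (by have := Finset.HasAntidiagonal.mem_antidiagonal.1 hp; omega)]

open PowerSeries in
lemma RR_step (t : K) {n : ℕ} (k : ℕ) (ν : Fin n → ℤ) (hν : IsSig ν) (c : Fin (k + 1) → K)
    (x : Fin n → K) (hx : ∀ i, x i ≠ 0) :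
    (∏ i, (1 - C (x i) * (C (c (Fin.last k)) * (X : PowerSeries K)))) *
        PowerSeries.mk (RR t (k + 1) ν c x)
    = (∏ i, (1 - C (t * x i) * (C (c (Fin.last k)) * (X : PowerSeries K)))) *
        PowerSeries.mk (RR t k ν (fun i => c i.castSucc) x) := by
  set y := c (Fin.last k) with hy
  ext d
  obtain ⟨A, B, hb⟩ := exists_bd ν
  set H : (Fin n → ℤ) → K := fun κ => HLQ t k ν κ (fun i => c i.castSucc) with hH
  have hHs : ∀ κ, H κ ≠ 0 → (∀ i, ν i ≤ κ i) ∧ (IsSig ν → IsSig κ) := fun κ h => HLQ_supp t k ν κ _ h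
  have hm : ∀ κ, H κ ≠ 0 → sumz κ = sumz ν + ((sumz κ - sumz ν).toNat : ℕ) := by
    intro κ h
    have := sumz_mono (hHs κ h).1
    omega
  rw [coeff_mul_congr _ (PowerSeries.mk (RR t (k + 1) ν c x)) (∑ κ ∈ bx n A (B + d), C (H κ) *
      (X ^ (sumz κ - sumz ν).toNat * PowerSeries.mk (fun f => y ^ f * qq t κ x f))) d,
    coeff_mul_congr _ (PowerSeries.mk (RR t k ν (fun i => c i.castSucc) x)) (∑ κ ∈ bx n A (B + d), C (H κ) *
      (X ^ (sumz κ - sumz ν).toNat * C (PP t n κ x))) d]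
  · congr 1
    rw [Finset.mul_sum, Finset.mul_sum]
    apply Finset.sum_congr rfl
    intro κ _
    by_cases h : H κ = 0
    · simp [h]
    have := pieri_rescale t κ x ((hHs κ h).2 hν) hx y
    linear_combination - C (H κ) * X ^ (sumz κ - sumz ν).toNat * this
  · intro b hbd
    rw [coeff_mk, RR_bx t k ν _ x b (A := A) (B := B + d) (fun i => by have := hb i; omega), map_sum]
    apply Finset.sum_congr rfl
    intro κ _
    by_cases h : H κ = 0
    · simp only [hH] at h; simp [h, hH]
    have h1 := hm κ h
    rw [coeff_C_mul, coeff_X_pow_mul', coeff_C]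
    by_cases h2 : sumz κ = sumz ν + b
    · rw [if_pos h2, if_pos (by omega), if_pos (by omega)]
    · rw [if_neg h2]
      split_ifs
      · omega
      · simp
      · simp
  · intro b hbd
    rw [coeff_mk, RR_bx t (k + 1) ν _ x b (A := A) (B := B + d) (fun i => by have := hb i; omega), map_sum]
    have e1 : ∀ l ∈ bx n A (B + d), 
       (if sumz l = sumz ν + b then HLQ t (k + 1) ν l c * PP t n l x else 0) =
       ∑ κ ∈ bx n A (B + d), H κ * (if sumz l = sumz ν + b then phiI t l κ * y ^ (sumz l - sumz κ) *
          PP t n l x else 0) := by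
      intro l hl
      split_ifs with h
      · rw [HLQ_succ, finsum_bx _ A (B + d), Finset.sum_mul]
        · apply Finset.sum_congr rfl
          intro κ _
          simp only [hH, hy]; ring
        · intro κ hκ i
          have h1 := HLQ_supp t k ν κ _ (right_ne_zero_of_mul hκ)
          have h2 := phiI_ne (left_ne_zero_of_mul (left_ne_zero_of_mul hκ))
          have h3 := mem_bx.1 hl i
          have h4 := h1.1 i
          have h5 := h2.1 i
          have h6 := hb i
          omega
      · simp
    rw [Finset.sum_congr rfl e1, Finset.sum_comm]
    apply Finset.sum_congr rfl
    intro κ _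
    rw [← Finset.mul_sum, coeff_C_mul]
    by_cases h : H κ = 0
    · simp [h]
    congr 1
    have h1 := hm κ h
    rw [coeff_X_pow_mul', coeff_mk]
    split_ifs with h2
    · rw [qq_bx t κ x _ (A := A) (B := B + d), Finset.mul_sum]
      · apply Finset.sum_congr rfl
        intro l _
        by_cases h3 : sumz l = sumz ν + b
        · rw [if_pos h3, if_pos (by omega)]
          have : sumz l - sumz κ = ((b - (sumz κ - sumz ν).toNat : ℕ) : ℤ) := by omega
          rw [this, zpow_natCast]; ring
        · rw [if_neg h3, if_neg (by omega)]; simp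
      · intro i
        have := le_of_sumz (hHs κ h).1 h1 i
        have := (hHs κ h).1 i
        have := hb i
        omega
    · apply Finset.sum_eq_zero
      intro l _
      split_ifs with h3
      · by_cases h4 : phiI t l κ = 0
        · simp [h4]
        · have := sumz_mono (phiI_ne h4).1
          omega
      · rfl

open PowerSeries in
lemma cauchy (t : K) {n : ℕ} (ν : Fin n → ℤ) (hν : IsSig ν)
    (x : Fin n → K) (hx : ∀ i, x i ≠ 0) : ∀ (s : ℕ) (c : Fin s → K),
    (∏ j, ∏ i, (1 - C (t * x i) * (C (c j) * (X : PowerSeries K)))) * C (PP t n ν x)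
    = (∏ j, ∏ i, (1 - C (x i) * (C (c j) * (X : PowerSeries K)))) *
        PowerSeries.mk (RR t s ν c x) := by
  intro s
  induction s with
  | zero =>
    intro c
    simp only [Finset.univ_eq_empty, Finset.prod_empty, one_mul]
    ext d
    rw [coeff_mk, coeff_C]
    unfold RR HLQ
    rw [finsum_eq_single _ ν]
    · by_cases h : d = 0
      · simp [h]
      · simp [h]
    · intro l hl
      simp [Ne.symm hl]
  | succ k ih =>
    intro c
    rw [Fin.prod_univ_castSucc, Fin.prod_univ_castSucc]
    have h1 := ih (fun i => c i.castSucc)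
    have h2 := RR_step t k ν hν c x hx
    rw [mul_assoc, mul_assoc, h2]
    linear_combination (∏ i, (1 - C (t * x i) * (C (c (Fin.last k)) * (X : PowerSeries K)))) * h1

end partF
end PartF

section PartG

section partG
variable {K : Type} [Field K]

lemma finsum_cast {k m : ℕ} (h : k = m) (F : (Fin k → ℤ) → K) :
    ∑ᶠ ν : Fin m → ℤ, F (fun i => ν (Fin.cast h i)) = ∑ᶠ μ, F μ := by
  subst h; rfl

lemma psiI_cast (t : K) {k m : ℕ} (h : k = m) (l : Fin (m + 1) → ℤ) (ν : Fin m → ℤ) :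
    psiI t (fun i => l (Fin.cast (by omega) i) : Fin (k + 1) → ℤ) (fun i => ν (Fin.cast h i))
      = psiI t l ν := by
  subst h; rfl

lemma sumz_cast {k m : ℕ} (h : k = m) (ν : Fin m → ℤ) :
    sumz (fun i => ν (Fin.cast h i)) = sumz ν := by
  subst h; rfl

lemma HLP_eq_PP (t : K) : ∀ (k : ℕ) (e : Fin 0 → ℤ) (l : Fin (0 + k) → ℤ) (x : Fin k → K),
    HLP t k e l x = PP t k (fun i => l (Fin.cast (Nat.zero_add k).symm i)) x := by
  intro k
  induction k with
  | zero =>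
    intro e l x
    unfold HLP PP
    rw [if_pos]
    funext i
    exact i.elim0
  | succ k ih =>
    intro e l x
    rw [HLP, PP, ← finsum_cast (Nat.zero_add k).symm]
    apply finsum_congr
    intro ν
    have h1 := psiI_cast t (Nat.zero_add k).symm l ν
    have h2 := sumz_cast (Nat.zero_add k).symm ν
    have h3 : sumz (fun i => l (Fin.cast (Nat.zero_add (k + 1)).symm i)) = sumz l :=
      sumz_cast (Nat.zero_add (k + 1)).symm l
    rw [h2, h3, ih]
    rw [h1]
    unfold psiI
    split_ifs <;> simp

lemma HLPfull_eq (t : K) {n : ℕ} (l : Fin n → ℤ) (x : Fin n → K) : HLPfull t l x = PP t n l x := by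
  unfold HLPfull
  rw [HLP_eq_PP]
  rfl

lemma PP_homog (t z : K) (hz : z ≠ 0) : ∀ (n : ℕ) (l : Fin n → ℤ) (x : Fin n → K),
    PP t n l (fun i => z * x i) = z ^ sumz l * PP t n l x := by
  intro n
  induction n with
  | zero => intro l x; simp [PP, sumz]
  | succ n ih =>
    intro l x
    obtain ⟨A, B, hb⟩ := exists_bd l
    rw [PP_succ_bx t l _ hb, PP_succ_bx t l _ hb, Finset.mul_sum]
    apply Finset.sum_congr rfl
    intro μ _
    rw [ih, mul_zpow]
    have : z ^ sumz l = z ^ (sumz l - sumz μ) * z ^ sumz μ := by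
      rw [← zpow_add₀ hz]; congr 1; ring
    rw [this]; ring

lemma psiI_pos {t : ℝ} (h0 : 0 < t) (h1 : t < 1) {n : ℕ} {l : Fin (n + 1) → ℤ} {μ : Fin n → ℤ}
    (h : interP μ l) : 0 < psiI t l μ := by
  unfold psiI psiHL
  rw [if_pos h]
  apply finprod_induction (fun r : ℝ => 0 < r)
  · norm_num
  · intro a b ha hb; positivity
  · intro c
    split_ifs with h
    · have : t ^ mcount μ c < 1 := pow_lt_one₀ h0.le h1 (by omega)
      linarith
    · norm_num

lemma interP_trunc {n : ℕ} {l : Fin (n + 1) → ℤ} (hl : IsSig l) :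
    interP (fun i : Fin n => l i.castSucc) l :=
  fun i => ⟨le_rfl, hl _ _ (Fin.castSucc_lt_succ).le⟩

lemma PP_pos {t : ℝ} (h0 : 0 < t) (h1 : t < 1) : ∀ (n : ℕ) (l : Fin n → ℤ) (x : Fin n → ℝ),
    (∀ i, 0 < x i) → 0 ≤ PP t n l x ∧ (IsSig l → 0 < PP t n l x) := by
  intro n
  induction n with
  | zero => intro l x _; simp [PP]
  | succ n ih =>
    intro l x hx
    obtain ⟨A, B, hb⟩ := exists_bd l
    rw [PP_succ_bx t l _ hb]
    have hnn : ∀ μ ∈ bx n A B, 0 ≤ psiI t l μ * x (Fin.last n) ^ (sumz l - sumz μ) *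
        PP t n μ (fun i => x i.castSucc) := by
      intro μ _
      have h2 := (ih μ (fun i => x i.castSucc) (fun i => hx _)).1
      have h3 : 0 ≤ psiI t l μ := by
        by_cases h : interP μ l
        · exact (psiI_pos h0 h1 h).le
        · simp [psiI, h]
      have := hx (Fin.last n)
      positivity
    refine ⟨Finset.sum_nonneg hnn, fun hl => ?_⟩
    apply Finset.sum_pos' hnn
    have hi := interP_trunc hl
    refine ⟨fun i => l i.castSucc, mem_bx.2 (interP_bd hi hb), ?_⟩
    have h2 := (ih (fun i => l i.castSucc) (fun i => x i.castSucc) (fun i => hx _)).2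
      (sig_of_interP hi).1
    have h3 := psiI_pos h0 h1 hi
    have := hx (Fin.last n)
    positivity

lemma laurent_zero {ι : Type} (S : Finset ι) (e : ι → ℤ) (a : ι → ℝ)
    (h : ∀ y : ℝ, 0 < y → ∑ i ∈ S, a i * y ^ e i = 0) (k : ℤ) :
    ∑ i ∈ S, (if e i = k then a i else 0) = 0 := by
  set M : ℕ := ∑ i ∈ S, (e i).natAbs with hM
  have hMi : ∀ i ∈ S, 0 ≤ e i + M := by
    intro i hi
    have : (e i).natAbs ≤ M := Finset.single_le_sum (f := fun i => (e i).natAbs)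
      (fun _ _ => Nat.zero_le _) hi
    omega
  set p : Polynomial ℝ := ∑ i ∈ S, Polynomial.monomial (e i + M).toNat (a i) with hp
  have hp0 : p = 0 := by
    apply Polynomial.eq_zero_of_infinite_isRoot
    apply Set.Infinite.mono (s := Set.Ioi (0 : ℝ)) _ (Set.Ioi_infinite 0)
    intro y hy
    have hy : 0 < y := hy
    show p.eval y = 0
    rw [hp, Polynomial.eval_finsetSum]
    have : ∀ i ∈ S, Polynomial.eval y (Polynomial.monomial (e i + M).toNat (a i))
       = y ^ M * (a i * y ^ e i) := by
      intro i hi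
      have h1 := hMi i hi
      rw [Polynomial.eval_monomial, ← zpow_natCast, Int.toNat_of_nonneg h1, zpow_add₀ hy.ne',
        zpow_natCast]
      ring
    rw [Finset.sum_congr rfl this, ← Finset.mul_sum, h y hy, mul_zero]
  by_cases hk : 0 ≤ k + M
  · have := congrArg (fun q => Polynomial.coeff q (k + M).toNat) hp0
    simp only [hp, Polynomial.finsetSum_coeff, Polynomial.coeff_zero, Polynomial.coeff_monomial] at this
    rw [← this]
    apply Finset.sum_congr rfl
    intro i hi
    have h1 := hMi i hi
    congr 1
    apply propext
    omega
  · apply Finset.sum_eq_zero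
    intro i hi
    have h1 := hMi i hi
    rw [if_neg (by omega)]

lemma PP_indep {t : ℝ} (h0 : 0 < t) (h1 : t < 1) : ∀ (n : ℕ) (S : Finset (Fin n → ℤ))
    (g : (Fin n → ℤ) → ℝ), (∀ l ∈ S, IsSig l) →
    (∀ x : Fin n → ℝ, (∀ i, 0 < x i) → ∑ l ∈ S, g l * PP t n l x = 0) → ∀ l ∈ S, g l = 0 := by
  intro n
  induction n with
  | zero =>
    intro S g _ h l hl
    have := h (fun _ => 1) (fun _ => one_pos)
    rw [Finset.sum_eq_single l] at this
    · simpa [PP] using this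
    · intro b _ hb; exact absurd (Subsingleton.elim _ _) hb
    · intro h; exact absurd hl h
  | succ n ih =>
    intro S g hS h
    obtain ⟨A, B, hb⟩ : ∃ A B : ℤ, ∀ l ∈ S, ∀ i, A ≤ l i ∧ l i ≤ B := by
      refine ⟨-∑ l ∈ S, ∑ i, |l i|, ∑ l ∈ S, ∑ i, |l i|, fun l hl i => ?_⟩
      have h2 : |l i| ≤ ∑ i, |l i| := Finset.single_le_sum (f := fun i => |l i|)
        (fun _ _ => abs_nonneg _) (Finset.mem_univ i)
      have h3 : ∑ i, |l i| ≤ ∑ l ∈ S, ∑ i, |l i| := Finset.single_le_sum (f := fun l => ∑ i, |l i|)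
        (fun _ _ => Finset.sum_nonneg (fun _ _ => abs_nonneg _)) hl
      exact abs_le.1 (h2.trans h3)
    have key : ∀ (k : ℤ) (μ : Fin n → ℤ), μ ∈ bx n A B → IsSig μ →
        ∑ l ∈ S, (if sumz l - sumz μ = k then g l * psiI t l μ else 0) = 0 := by
      intro k μ hμ hμs
      refine ih ((bx n A B).filter IsSig)
        (fun μ => ∑ l ∈ S, (if sumz l - sumz μ = k then g l * psiI t l μ else 0))
        (fun l hl => (Finset.mem_filter.1 hl).2) ?_ μ (Finset.mem_filter.2 ⟨hμ, hμs⟩)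
      intro x hx
      have hL := laurent_zero (S ×ˢ bx n A B) (fun p => sumz p.1 - sumz p.2)
        (fun p => g p.1 * psiI t p.1 p.2 * PP t n p.2 x) (by
          intro y hy
          have := h (Fin.snoc (α := fun _ => ℝ) x y) (by
            intro i
            refine Fin.lastCases ?_ (fun i => ?_) i
            · simpa using hy
            · simpa using hx i)
          rw [← this, Finset.sum_product]
          apply Finset.sum_congr rfl
          intro l hl
          rw [PP_succ_bx t l _ (hb l hl), Finset.mul_sum]
          apply Finset.sum_congr rfl
          intro μ _
          simp only [Fin.snoc_last, Fin.snoc_castSucc]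
          ring) k
      rw [Finset.sum_product, Finset.sum_comm] at hL
      refine Eq.trans ?_ hL
      rw [Finset.sum_filter_of_ne]
      · apply Finset.sum_congr rfl
        intro μ _
        rw [Finset.sum_mul]
        apply Finset.sum_congr rfl
        intro l _
        split_ifs <;> simp
      · intro μ _ h
        exact PP_sig t (right_ne_zero_of_mul h)
    by_contra hcon
    push Not at hcon
    obtain ⟨l1, hl1, hg1⟩ := hcon
    obtain ⟨l0, hl0, hmin⟩ := Finset.exists_min_image (S.filter (fun l => g l ≠ 0))
      (fun l => l (Fin.last n)) ⟨l1, Finset.mem_filter.2 ⟨hl1, hg1⟩⟩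
    rw [Finset.mem_filter] at hl0
    have hi := interP_trunc (hS l0 hl0.1)
    have := key (sumz l0 - sumz (fun i : Fin n => l0 i.castSucc)) (fun i => l0 i.castSucc)
      (mem_bx.2 (interP_bd hi (hb l0 hl0.1))) (sig_of_interP hi).1
    rw [Finset.sum_eq_single l0] at this
    · rw [if_pos rfl] at this
      exact mul_ne_zero hl0.2 (psiI_pos h0 h1 hi).ne' this
    · intro l hl hne
      split_ifs with hs
      · by_contra hgl
        apply hne
        have hg := left_ne_zero_of_mul hgl
        have hil := psiI_ne (right_ne_zero_of_mul hgl)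
        have hm := hmin l (Finset.mem_filter.2 ⟨hl, hg⟩)
        have hle : ∀ i, l0 i ≤ l i := by
          intro i
          refine Fin.lastCases ?_ (fun i => ?_) i
          · exact hm
          · exact (hil i).1
        funext i
        have h3 := le_of_sumz (d := 0) hle (by omega) i
        have := hle i
        omega
      · rfl
    · intro h; exact absurd hl0.1 h

end partG
end PartG

section PartH

section partH

lemma prod_double {M : Type} [CommMonoid M] {K : Type} [Field K] {n : ℕ} (t : K) (x : Fin n → K)
    (f : K → M) : ∏ i, f (doubleList t x i) = ∏ i, f (x i) * f (x i * t) := by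
  rw [← Fintype.prod_equiv (finProdFinEquiv.trans (finCongr (mul_comm n 2)))
    (fun p : Fin n × Fin 2 => f (x p.1 * t ^ (p.2 : ℕ))) _ (fun p => ?_), Fintype.prod_prod_type]
  · simp [Fin.prod_univ_two]
  · obtain ⟨i, j⟩ := p
    unfold doubleList
    have h1 : ((j : ℕ) + 2 * i) / 2 = i := by omega
    have h2 : ((j : ℕ) + 2 * i) % 2 = j := by omega
    simp [h1, h2]

lemma mcount_zero (n : ℕ) (c : ℤ) : mcount (fun _ : Fin n => (0 : ℤ)) c = if c = 0 then n else 0 := by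
  unfold mcount
  split_ifs with h
  · subst h; simp
  · simp [Ne.symm h]

lemma PP_zero {K : Type} [Field K] (t : K) : ∀ (n : ℕ) (x : Fin n → K),
    PP t n (fun _ => 0) x = 1 := by
  intro n
  induction n with
  | zero => intro x; rfl
  | succ n ih =>
    intro x
    rw [PP, finsum_eq_single _ (fun _ => 0)]
    · rw [ih]
      have : psiI t (fun _ : Fin (n + 1) => (0 : ℤ)) (fun _ : Fin n => (0 : ℤ)) = 1 := by
        unfold psiI psiHL
        rw [if_pos (by intro i; simp)]
        apply finprod_eq_one_of_forall_eq_one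
        intro c
        rw [if_neg]
        rw [mcount_zero, mcount_zero]
        by_cases hc0 : c = 0
        · simp only [hc0, if_true]; omega
        · simp [hc0]
      rw [this]
      simp [sumz]
    · intro μ hμ
      by_cases h : psiI t (fun _ => 0) μ = 0
      · simp [h]
      · exfalso
        apply hμ
        funext i
        have := psiI_ne h i
        omega

lemma double_pos {n : ℕ} {t : ℝ} (h0 : 0 < t) {x : Fin n → ℝ} (hx : ∀ i, 0 < x i) :
    ∀ i, 0 < doubleList t x i := by
  intro i
  unfold doubleList
  have := hx ⟨i.val / 2, by have := i.isLt; omega⟩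
  positivity

open PowerSeries in
lemma fac_ne (a b : ℝ) : (1 - C a * (C b * (X : PowerSeries ℝ))) ≠ 0 := by
  intro h
  have := congrArg (constantCoeff (R := ℝ)) h
  simp at this

open PowerSeries in
lemma RR_compare {n s : ℕ} {t : ℝ} (h0 : 0 < t) (x : Fin n → ℝ) (hx : ∀ i, 0 < x i)
    (cc : Fin s → ℝ) (lam : Fin n → ℤ) (hl : IsSig lam) (d : ℕ) :
    RR t s (fun _ => 0) cc (doubleList t x) d * PP (t ^ 2) n lam x = RR (t ^ 2) s lam cc x d := by
  have c1 := cauchy t (fun _ : Fin (2 * n) => (0 : ℤ)) (fun _ _ _ => le_rfl) (doubleList t x)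
    (fun i => (double_pos h0 hx i).ne') s cc
  have c2 := cauchy (t ^ 2) lam hl x (fun i => (hx i).ne') s cc
  rw [PP_zero, map_one, mul_one] at c1
  have e1 : ∀ j, ∏ i, (1 - C (t * doubleList t x i) * (C (cc j) * (X : PowerSeries ℝ))) =
     (∏ i, (1 - C (t * x i) * (C (cc j) * (X : PowerSeries ℝ)))) *
      ∏ i, (1 - C (t ^ 2 * x i) * (C (cc j) * (X : PowerSeries ℝ))) := by
    intro j
    rw [prod_double t x (fun z => (1 - C (t * z) * (C (cc j) * (X : PowerSeries ℝ)))),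
      Finset.prod_mul_distrib]
    congr 1
    apply Finset.prod_congr rfl
    intro i _
    rw [show t * (x i * t) = t ^ 2 * x i by ring]
  have e2 : ∀ j, ∏ i, (1 - C (doubleList t x i) * (C (cc j) * (X : PowerSeries ℝ))) =
     (∏ i, (1 - C (x i) * (C (cc j) * (X : PowerSeries ℝ)))) *
      ∏ i, (1 - C (t * x i) * (C (cc j) * (X : PowerSeries ℝ))) := by
    intro j
    rw [prod_double t x (fun z => (1 - C z * (C (cc j) * (X : PowerSeries ℝ)))),
      Finset.prod_mul_distrib]
    congr 1
    apply Finset.prod_congr rfl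
    intro i _
    rw [show (x i * t) = t * x i by ring]
  simp only [e1, e2, Finset.prod_mul_distrib] at c1
  have n1 : (∏ j, ∏ i, (1 - C (t * x i) * (C (cc j) * (X : PowerSeries ℝ)))) ≠ 0 :=
    Finset.prod_ne_zero_iff.2 fun j _ => Finset.prod_ne_zero_iff.2 fun i _ => fac_ne _ _
  have n2 : (∏ j, ∏ i, (1 - C (x i) * (C (cc j) * (X : PowerSeries ℝ)))) ≠ 0 :=
    Finset.prod_ne_zero_iff.2 fun j _ => Finset.prod_ne_zero_iff.2 fun i _ => fac_ne _ _
  have c3 : (∏ j, ∏ i, (1 - C (t ^ 2 * x i) * (C (cc j) * (X : PowerSeries ℝ))))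
     = (∏ j, ∏ i, (1 - C (x i) * (C (cc j) * (X : PowerSeries ℝ)))) *
       PowerSeries.mk (RR t s (fun _ => 0) cc (doubleList t x)) := by
    apply mul_left_cancel₀ n1
    rw [c1]; ring
  rw [c3, mul_assoc] at c2
  have := congrArg (coeff d) (mul_left_cancel₀ n2 c2)
  rwa [coeff_mul_C, coeff_mk, coeff_mk] at this

lemma alt_finsum {n : ℕ} {μ : Fin (2 * n) → ℤ} {lam : Fin n → ℤ} {c : (Fin n → ℤ) → Polynomial ℤ}
    (h : altExpand n μ lam c) (t : ℝ) (S : Finset (Fin n → ℤ)) (hS : ∀ l, c l ≠ 0 → l ∈ S)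
    (x : Fin n → ℝ) (hx : ∀ i, 0 < x i) :
    PP t (2 * n) μ (doubleList t x) * PP (t ^ 2) n lam x =
      ∑ l ∈ S, Polynomial.aeval t (c l) * PP (t ^ 2) n l x := by
  have := h.2.2 ℝ t x (fun i => (hx i).ne')
  simp only [HLPfull_eq] at this
  rw [this]
  apply finsum_eq_sum_of_support_subset
  intro l hl
  apply hS
  intro h0
  simp [h0] at hl

lemma alt_degree {n : ℕ} {μ : Fin (2 * n) → ℤ} {lam : Fin n → ℤ} {c : (Fin n → ℤ) → Polynomial ℤ}
    (h : altExpand n μ lam c) {t : ℝ} (h0 : 0 < t) (h1 : t < 1) (l : Fin n → ℤ)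
    (hl : Polynomial.aeval t (c l) ≠ 0) : sumz l = sumz μ + sumz lam := by
  have hS : ∀ l, c l ≠ 0 → l ∈ h.1.toFinset := by
    intro l hl
    simpa using hl
  have hcl : c l ≠ 0 := by
    intro h'
    simp [h'] at hl
  have := PP_indep (t := t ^ 2) (by positivity) (pow_lt_one₀ h0.le h1 two_ne_zero) n h.1.toFinset
    (fun l => ((2 : ℝ) ^ sumz l - 2 ^ (sumz μ + sumz lam)) * Polynomial.aeval t (c l))
    (fun l hl => h.2.1 l (by simpa using hl)) (by
      intro x hx
      have a1 := alt_finsum h t _ hS x hx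
      have a2 := alt_finsum h t _ hS (fun i => 2 * x i) (fun i => by have := hx i; positivity)
      have hd : doubleList t (fun i => 2 * x i) = fun i => 2 * doubleList t x i := by
        funext i
        unfold doubleList
        ring
      rw [hd] at a2
      simp only [PP_homog _ (2 : ℝ) two_ne_zero] at a2
      have e : ∑ l ∈ h.1.toFinset, ((2 : ℝ) ^ sumz l - 2 ^ (sumz μ + sumz lam)) *
          Polynomial.aeval t (c l) * PP (t ^ 2) n l x = 
          ∑ l ∈ h.1.toFinset, Polynomial.aeval t (c l) * (2 ^ sumz l * PP (t ^ 2) n l x) -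
          2 ^ (sumz μ + sumz lam) * ∑ l ∈ h.1.toFinset, Polynomial.aeval t (c l) * PP (t ^ 2) n l x := by
        rw [Finset.mul_sum, ← Finset.sum_sub_distrib]
        apply Finset.sum_congr rfl
        intro l _
        ring
      rw [e, ← a1, ← a2, zpow_add₀ (two_ne_zero)]
      ring) l (hS l hcl)
  have h3 := (mul_eq_zero.1 this).resolve_right hl
  exact zpow_right_injective₀ (a := (2 : ℝ)) (by norm_num) (by norm_num) (sub_eq_zero.1 h3)

lemma coef_identity {n s : ℕ} {t : ℝ} (h0 : 0 < t) (h1 : t < 1) (cc : Fin s → ℝ)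
    (lam lam' : Fin n → ℤ) (hlam : IsSig lam) (hlam' : IsSig lam')
    (c : (Fin (2 * n) → ℤ) → (Fin n → ℤ) → Polynomial ℤ)
    (hc : ∀ μ : Fin (2 * n) → ℤ, IsSig μ → (∀ i, 0 ≤ μ i) → altExpand n μ lam (c μ)) (d : ℕ)
    (hd : sumz lam' = sumz lam + d) :
    ∑ μ ∈ (bx (2 * n) 0 d).filter (fun μ => IsSig μ ∧ (∀ i, 0 ≤ μ i) ∧ sumz μ = d),
      HLQ t s (fun _ => 0) μ cc * Polynomial.aeval t (c μ lam') = HLQ (t ^ 2) s lam lam' cc := by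
  obtain ⟨A, B, hb⟩ := exists_bd lam
  set G := (bx (2 * n) 0 d).filter (fun μ => IsSig μ ∧ (∀ i, 0 ≤ μ i) ∧ sumz μ = d) with hG
  have hGa : ∀ μ ∈ G, altExpand n μ lam (c μ) := by
    intro μ hμ
    have := (Finset.mem_filter.1 hμ).2
    exact hc μ this.1 this.2.1
  set U : Finset (Fin n → ℤ) := G.attach.biUnion (fun μ => (hGa μ.1 μ.2).1.toFinset) with hU
  set S : Finset (Fin n → ℤ) := insert lam' (U ∪ (bx n A (B + d)).filter IsSig) with hS
  have hUS : ∀ μ ∈ G, ∀ l, c μ l ≠ 0 → l ∈ S := by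
    intro μ hμ l hl
    rw [hS]
    apply Finset.mem_insert_of_mem
    apply Finset.mem_union_left
    rw [hU, Finset.mem_biUnion]
    exact ⟨⟨μ, hμ⟩, Finset.mem_attach _ _, by simpa using hl⟩
  have hSs : ∀ l ∈ S, IsSig l := by
    intro l hl
    rw [hS, Finset.mem_insert, Finset.mem_union] at hl
    rcases hl with hl | hl | hl
    · rw [hl]; exact hlam'
    · rw [hU, Finset.mem_biUnion] at hl
      obtain ⟨μ, _, hl⟩ := hl
      exact (hGa μ.1 μ.2).2.1 l (by simpa using hl)
    · exact (Finset.mem_filter.1 hl).2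
  have key := PP_indep (t := t ^ 2) (by positivity) (pow_lt_one₀ h0.le h1 two_ne_zero) n S
    (fun l => ∑ μ ∈ G, HLQ t s (fun _ => 0) μ cc * Polynomial.aeval t (c μ l) -
      if sumz l = sumz lam + d then HLQ (t ^ 2) s lam l cc else 0) hSs (by
      intro x hx
      have hR := RR_compare (s := s) h0 x hx cc lam hlam d
      have e1 : RR t s (fun _ => 0) cc (doubleList t x) d * PP (t ^ 2) n lam x =
          ∑ l ∈ S, (∑ μ ∈ G, HLQ t s (fun _ => 0) μ cc * Polynomial.aeval t (c μ l)) *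
            PP (t ^ 2) n l x := by
        have : RR t s (fun _ => 0) cc (doubleList t x) d = ∑ μ ∈ G, HLQ t s (fun _ => 0) μ cc *
            PP t (2 * n) μ (doubleList t x) := by
          rw [RR_bx t s _ cc _ d (A := 0) (B := d) (fun i => by simp), hG, Finset.sum_filter]
          apply Finset.sum_congr rfl
          intro μ _
          by_cases hQ : HLQ t s (fun _ => 0) μ cc = 0
          · simp [hQ]
          have h2 := HLQ_supp t s _ μ cc hQ
          have h3 : sumz (fun _ : Fin (2 * n) => (0 : ℤ)) = 0 := by simp [sumz]
          rw [h3, zero_add]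
          have h4 : IsSig μ := h2.2 (fun _ _ _ => le_rfl)
          have h5 : ∀ i, 0 ≤ μ i := h2.1
          simp only [h4, true_and, h5, implies_true]
        rw [this, Finset.sum_mul]
        simp only [Finset.sum_mul]
        rw [Finset.sum_comm]
        apply Finset.sum_congr rfl
        intro μ hμ
        rw [mul_assoc, alt_finsum (hGa μ hμ) t S (hUS μ hμ) x hx, Finset.mul_sum]
        apply Finset.sum_congr rfl
        intro l _
        ring
      have e2 : RR (t ^ 2) s lam cc x d = ∑ l ∈ S,
          (if sumz l = sumz lam + d then HLQ (t ^ 2) s lam l cc else 0) * PP (t ^ 2) n l x := by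
        unfold RR
        have : ∀ l, (if sumz l = sumz lam + d then HLQ (t ^ 2) s lam l cc * PP (t ^ 2) n l x else 0)
          = (if sumz l = sumz lam + d then HLQ (t ^ 2) s lam l cc else 0) * PP (t ^ 2) n l x := by
          intro l; split_ifs <;> simp
        simp only [this]
        apply finsum_eq_sum_of_support_subset
        intro l hl
        have hl' := left_ne_zero_of_mul hl
        split_ifs at hl' with h2
        swap
        · exact absurd rfl hl'
        have h3 := HLQ_supp _ s _ l cc hl'
        rw [hS]
        apply Finset.mem_insert_of_mem
        apply Finset.mem_union_right
        refine Finset.mem_filter.2 ⟨mem_bx.2 (fun i => ?_), h3.2 hlam⟩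
        have h4 := le_of_sumz h3.1 h2 i
        have := h3.1 i
        have := hb i
        omega
      simp only [sub_mul]
      rw [Finset.sum_sub_distrib, ← e1, ← e2, hR, sub_self]) lam' (Finset.mem_insert_self _ _)
  simp only [hd, if_true] at key
  exact sub_eq_zero.1 key

lemma sum_identity {n s : ℕ} {t : ℝ} (h0 : 0 < t) (h1 : t < 1) (cc : Fin s → ℝ)
    (lam lam' : Fin n → ℤ) (hlam : IsSig lam) (hlam' : IsSig lam')
    (c : (Fin (2 * n) → ℤ) → (Fin n → ℤ) → Polynomial ℤ)
    (hc : ∀ μ : Fin (2 * n) → ℤ, IsSig μ → (∀ i, 0 ≤ μ i) → altExpand n μ lam (c μ)) :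
    ∑ᶠ μ : Fin (2 * n) → ℤ, (if IsSig μ ∧ ∀ i, 0 ≤ μ i then
      HLQ t s (fun _ => 0) μ cc * Polynomial.aeval t (c μ lam') else 0)
      = HLQ (t ^ 2) s lam lam' cc := by
  have hdeg : ∀ μ : Fin (2 * n) → ℤ, IsSig μ → (∀ i, 0 ≤ μ i) → Polynomial.aeval t (c μ lam') ≠ 0 →
      sumz lam' = sumz μ + sumz lam ∧ 0 ≤ sumz μ := fun μ h2 h3 h4 =>
    ⟨alt_degree (hc μ h2 h3) h0 h1 lam' h4, Finset.sum_nonneg (fun i _ => h3 i)⟩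
  by_cases hneg : sumz lam ≤ sumz lam'
  · obtain ⟨d, hd⟩ : ∃ d : ℕ, sumz lam' = sumz lam + d := ⟨(sumz lam' - sumz lam).toNat, by omega⟩
    rw [← coef_identity h0 h1 cc lam lam' hlam hlam' c hc d hd, finsum_bx _ 0 d, Finset.sum_filter]
    · apply Finset.sum_congr rfl
      intro μ _
      by_cases h2 : IsSig μ ∧ ∀ i, 0 ≤ μ i
      · rw [if_pos h2]
        by_cases h3 : Polynomial.aeval t (c μ lam') = 0
        · simp [h3]
        · have := hdeg μ h2.1 h2.2 h3
          rw [if_pos ⟨h2.1, h2.2, by omega⟩]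
      · rw [if_neg h2, if_neg (fun h => h2 ⟨h.1, h.2.1⟩)]
    · intro μ h i
      split_ifs at h with h2
      · have h3 := hdeg μ h2.1 h2.2 (right_ne_zero_of_mul h)
        have h4 := le_of_sumz (ν := fun _ => 0) (d := d) h2.2 (by
          have : sumz (fun _ : Fin (2 * n) => (0 : ℤ)) = 0 := by simp [sumz]
          omega) i
        have := h2.2 i
        omega
      · exact absurd rfl h
  · have e : HLQ (t ^ 2) s lam lam' cc = 0 := by
      by_contra h
      exact hneg (sumz_mono (HLQ_supp _ s _ _ cc h).1)
    rw [e]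
    apply finsum_eq_zero_of_forall_eq_zero
    intro μ
    split_ifs with h2
    · by_cases h3 : Polynomial.aeval t (c μ lam') = 0
      · simp [h3]
      · have := hdeg μ h2.1 h2.2 h3
        omega
    · rfl

lemma PiK_ne {n r : ℕ} {τ : ℝ} (h0 : 0 < τ) (h1 : τ < 1) (a : Fin n → ℝ) (ha : ∀ i, 0 < a i)
    (b : Fin r → ℝ) (hb : ∀ j, 0 ≤ b j) (hab : ∀ i j, a i * b j < 1) : PiK τ a b ≠ 0 := by
  unfold PiK
  refine Finset.prod_ne_zero_iff.2 fun i _ => Finset.prod_ne_zero_iff.2 fun j _ => ?_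
  have h2 := hab i j
  have h3 : 0 ≤ a i * b j := mul_nonneg (ha i).le (hb j)
  have h4 : τ * (a i * b j) < 1 := by nlinarith
  rw [mul_assoc]
  exact div_ne_zero (by linarith) (by linarith)

lemma PiK_double {n r : ℕ} {t : ℝ} (h0 : 0 < t) (h1 : t < 1) (a : Fin n → ℝ) (ha : ∀ i, 0 < a i)
    (b : Fin r → ℝ) (hb : ∀ j, 0 ≤ b j) (hab : ∀ i j, a i * b j < 1) :
    PiK t (doubleList t a) b = PiK (t ^ 2) a b := by
  unfold PiK
  rw [prod_double t a (fun z => ∏ j, (1 - t * z * b j) / (1 - z * b j))]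
  apply Finset.prod_congr rfl
  intro i _
  rw [← Finset.prod_mul_distrib]
  apply Finset.prod_congr rfl
  intro j _
  have h2 := hab i j
  have h3 : 0 ≤ a i * b j := mul_nonneg (ha i).le (hb j)
  have h4 : t * (a i * b j) < 1 := by nlinarith
  have h5 : 1 - a i * b j ≠ 0 := by linarith
  have h6 : 1 - t * a i * b j ≠ 0 := by rw [mul_assoc]; linarith
  have h7 : 1 - a i * t * b j = 1 - t * a i * b j := by ring
  have h8 : t * (a i * t) = t ^ 2 * a i := by ring
  rw [h7, h8, div_mul_div_comm, mul_comm (1 - a i * b j), mul_div_mul_left _ _ h6]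

end partH

end PartH

/-- the alternating product convolution yields a Hall–Littlewood process
(case `k = 1`): the joint probability that a Hall–Littlewood-distributed `ν` equals `λ` and
`μ ⊠ᵃˡᵗ ν` equals `λ'` is given by the Hall–Littlewood process formula, and all denominators
appearing are nonzero. -/
theorem stmt18 (n r s : ℕ) (hn : 1 ≤ n) (t : ℝ) (ht0 : 0 < t) (ht1 : t < 1)
    (a : Fin n → ℝ) (ha : ∀ i, 0 < a i)
    (b : Fin r → ℝ) (hb : ∀ j, 0 ≤ b j)
    (cc : Fin s → ℝ) (hcc : ∀ j, 0 ≤ cc j)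
    (hab : ∀ i j, a i * b j < 1) (hac : ∀ i j, a i * cc j < 1)
    (lam lam' : Fin n → ℤ) (hlam : IsSig lam) (hlam0 : ∀ i, 0 ≤ lam i)
    (hlam' : IsSig lam') (hlam'0 : ∀ i, 0 ≤ lam' i)
    (c : (Fin (2 * n) → ℤ) → (Fin n → ℤ) → Polynomial ℤ)
    (hc : ∀ μ : Fin (2 * n) → ℤ, IsSig μ → (∀ i, 0 ≤ μ i) → altExpand n μ lam (c μ)) :
    PiK (t ^ 2) a b ≠ 0 ∧ PiK (t ^ 2) a cc ≠ 0 ∧ PiK t (doubleList t a) cc ≠ 0 ∧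
    HLPfull (t ^ 2) lam a ≠ 0 ∧
    (∀ μ : Fin (2 * n) → ℤ, IsSig μ → (∀ i, 0 ≤ μ i) → HLPfull t μ (doubleList t a) ≠ 0) ∧
    (HLPfull (t ^ 2) lam a * HLQ (t ^ 2) r (fun _ => 0) lam b / PiK (t ^ 2) a b) *
        (∑ᶠ μ : Fin (2 * n) → ℤ,
          if IsSig μ ∧ ∀ i, 0 ≤ μ i then
            (HLPfull t μ (doubleList t a) * HLQ t s (fun _ => 0) μ cc /
                PiK t (doubleList t a) cc) *
              (Polynomial.aeval t (c μ lam') * HLPfull (t ^ 2) lam' a /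
                (HLPfull t μ (doubleList t a) * HLPfull (t ^ 2) lam a))
          else 0)
      = HLQ (t ^ 2) r (fun _ => 0) lam b * HLQ (t ^ 2) s lam lam' cc *
          HLPfull (t ^ 2) lam' a / (PiK (t ^ 2) a b * PiK (t ^ 2) a cc) := by
  have ht20 : 0 < t ^ 2 := by positivity
  have ht21 : t ^ 2 < 1 := pow_lt_one₀ ht0.le ht1 two_ne_zero
  have p1 := PiK_ne ht20 ht21 a ha b hb hab
  have p2 := PiK_ne ht20 ht21 a ha cc hcc hac
  have p3 : HLPfull (t ^ 2) lam a ≠ 0 := by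
    rw [HLPfull_eq]
    exact ((PP_pos ht20 ht21 n lam a ha).2 hlam).ne'
  have p4 : ∀ μ : Fin (2 * n) → ℤ, IsSig μ → (∀ i, 0 ≤ μ i) → HLPfull t μ (doubleList t a) ≠ 0 := by
    intro μ hμ _
    rw [HLPfull_eq]
    exact ((PP_pos ht0 ht1 (2 * n) μ _ (double_pos ht0 ha)).2 hμ).ne'
  rw [PiK_double ht0 ht1 a ha cc hcc hac]
  refine ⟨p1, p2, p2, p3, p4, ?_⟩
  have e : ∀ μ : Fin (2 * n) → ℤ, (if IsSig μ ∧ ∀ i, 0 ≤ μ i then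
            (HLPfull t μ (doubleList t a) * HLQ t s (fun _ => 0) μ cc / PiK (t ^ 2) a cc) *
              (Polynomial.aeval t (c μ lam') * HLPfull (t ^ 2) lam' a /
                (HLPfull t μ (doubleList t a) * HLPfull (t ^ 2) lam a))
          else 0) = (HLPfull (t ^ 2) lam' a / (PiK (t ^ 2) a cc * HLPfull (t ^ 2) lam a)) •
          (if IsSig μ ∧ ∀ i, 0 ≤ μ i then
      HLQ t s (fun _ => 0) μ cc * Polynomial.aeval t (c μ lam') else 0) := by
    intro μ
    split_ifs with h
    · have := p4 μ h.1 h.2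
      rw [smul_eq_mul]
      field_simp
    · simp
  simp only [e]
  rw [← smul_finsum, sum_identity ht0 ht1 cc lam lam' hlam hlam' c hc, smul_eq_mul]
  field_simp

end
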